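/- arXiv:1602.00757 — 4 statements merged into one kernel-verified Lean document; each statement's English description precedes it below -/
import Mathlib

section
/- Let n ≥ 1. Then lim_{ε→0} ∫_{|y|<ε} S(ε²) H(ε², y) dy = (1/Γ(n/2)) ∫₀^{1/4} e^{−u} u^{n/2 − 1} du. -/
open MeasureTheory Filter Set Metric
open scoped ENNReal NNReal Topology

noncomputable section

abbrev En (n : ℕ) := EuclideanSpace ℝ (Fin n)

/-- The hyperbolic cotangent. -/
def coth (τ : ℝ) : ℝ := Real.cosh τ / Real.sinh τ

/-- The factor `S(τ) = (2π sinh 2τ)^{-n/2}` of the Mehler kernel. -/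
def Sfac (n : ℕ) (τ : ℝ) : ℝ := (2 * Real.pi * Real.sinh (2 * τ)) ^ (-(n : ℝ) / 2)

/-- The factor `H(τ,y) = exp(-(1/4)|y|² coth τ)` of the Mehler kernel. -/
def Hker (n : ℕ) (τ : ℝ) (y : En n) : ℝ := Real.exp (-(1 / 4) * ‖y‖ ^ 2 * coth τ)

/-- Partial derivative of `g : ℝⁿ → ℝ` in the `i`-th coordinate direction. -/
def pd {n : ℕ} (i : Fin n) (g : En n → ℝ) (y : En n) : ℝ :=
  fderiv ℝ g y (EuclideanSpace.single i 1)

/-- The substitution `u = r² / 4` in the lower incomplete Gamma integral. -/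
theorem setIntegral_Ioo_exp_neg_mul_rpow {n : ℕ} (hn : 1 ≤ n) :
    ∫ u in Ioo (0 : ℝ) (1 / 4), Real.exp (-u) * u ^ ((n : ℝ) / 2 - 1) =
      (1 / 2) ^ (n - 1) * ∫ r in Ioo (0 : ℝ) 1, r ^ (n - 1) * Real.exp (-(r ^ 2 / 4)) := by
  have himage : (fun r : ℝ => r ^ 2 / 4) '' Ioo 0 1 = Ioo 0 (1 / 4) := by
    ext u
    simp only [mem_image, mem_Ioo]
    constructor
    · rintro ⟨r, ⟨h0, h1⟩, rfl⟩
      constructor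
      · positivity
      · nlinarith
    · rintro ⟨h0, h1⟩
      refine ⟨√(4 * u), ⟨Real.sqrt_pos.2 (by positivity), ?_⟩, ?_⟩
      · rw [Real.sqrt_lt' one_pos]
        linarith
      · rw [Real.sq_sqrt (by positivity)]
        ring
  have hderiv (r : ℝ) (_ : r ∈ Ioo (0 : ℝ) 1) :
      HasDerivWithinAt (fun r : ℝ => r ^ 2 / 4) (r / 2) (Ioo 0 1) r := by
    refine (((hasDerivAt_pow 2 r).div_const 4).congr_deriv ?_).hasDerivWithinAt
    norm_num
    ring
  have hinj : InjOn (fun r : ℝ => r ^ 2 / 4) (Ioo 0 1) := by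
    intro a ha b hb hab
    have hsq : a ^ 2 = b ^ 2 := by
      simp only at hab
      linarith
    exact (pow_left_inj₀ ha.1.le hb.1.le two_ne_zero).1 hsq
  rw [← himage, integral_image_eq_integral_abs_deriv_smul measurableSet_Ioo hderiv hinj,
    ← integral_const_mul]
  refine setIntegral_congr_fun measurableSet_Ioo fun r hr => ?_
  have hr0 : 0 < r / 2 := half_pos hr.1
  have hpow : (r ^ 2 / 4) ^ ((n : ℝ) / 2 - 1) * (r / 2) = (r / 2) ^ (n - 1) := by
    rw [show r ^ 2 / 4 = (r / 2) ^ (2 : ℝ) by rw [Real.rpow_two]; ring, ← Real.rpow_mul hr0.le,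
      ← Real.rpow_add_one hr0.ne', ← Real.rpow_natCast, Nat.cast_sub hn]
    congr 1
    push_cast
    ring
  simp only [smul_eq_mul]
  rw [abs_of_pos hr0, mul_left_comm, mul_comm (r / 2), hpow, div_eq_mul_one_div r 2, mul_pow]
  ring

/-- The heat-kernel mass of the unit ball at time one is a normalized incomplete Gamma function. -/
theorem setIntegral_ball_exp_neg_norm_sq_div_four {n : ℕ} (hn : 1 ≤ n) :
    (4 * Real.pi) ^ (-(n : ℝ) / 2) * ∫ y in ball (0 : En n) 1, Real.exp (-(‖y‖ ^ 2 / 4)) =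
      (1 / Real.Gamma ((n : ℝ) / 2)) *
        ∫ u in Ioo (0 : ℝ) (1 / 4), Real.exp (-u) * u ^ ((n : ℝ) / 2 - 1) := by
  have : Nonempty (Fin n) := Fin.pos_iff_nonempty.mp hn
  have hn0 : (0 : ℝ) < n / 2 := by
    have : (0 : ℝ) < n := by exact_mod_cast hn
    positivity
  have hpolar : ∫ y in ball (0 : En n) 1, Real.exp (-(‖y‖ ^ 2 / 4)) =
      n * volume.real (ball (0 : En n) 1) *
        ∫ r in Ioo (0 : ℝ) 1, r ^ (n - 1) * Real.exp (-(r ^ 2 / 4)) := by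
    have h := integral_fun_norm_addHaar (volume : Measure (En n))
      ((Iio 1).indicator fun r : ℝ => Real.exp (-(r ^ 2 / 4)))
    have hleft : (fun y : En n => (Iio 1).indicator (fun r : ℝ => Real.exp (-(r ^ 2 / 4))) ‖y‖) =
        (ball (0 : En n) 1).indicator fun y => Real.exp (-(‖y‖ ^ 2 / 4)) := by
      ext y
      simp [indicator]
    have hright : (fun r : ℝ => r ^ (n - 1) •
          (Iio 1).indicator (fun r : ℝ => Real.exp (-(r ^ 2 / 4))) r) =
        (Iio 1).indicator fun r : ℝ => r ^ (n - 1) * Real.exp (-(r ^ 2 / 4)) := by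
      ext r
      simp [indicator]
    rw [finrank_euclideanSpace, Fintype.card_fin, hleft, hright,
      integral_indicator measurableSet_ball,
      setIntegral_indicator measurableSet_Iio, Ioi_inter_Iio] at h
    rw [h, nsmul_eq_mul, smul_eq_mul, mul_assoc]
  have hvol : volume.real (ball (0 : En n) 1) =
      √Real.pi ^ n / ((n : ℝ) / 2 * Real.Gamma ((n : ℝ) / 2)) := by
    rw [Measure.real, EuclideanSpace.volume_ball, Fintype.card_fin, Real.Gamma_add_one hn0.ne']
    have := Real.Gamma_pos_of_pos hn0
    rw [ENNReal.ofReal_one, one_pow, one_mul, ENNReal.toReal_ofReal (by positivity)]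
  have hconst : (4 * Real.pi) ^ (-(n : ℝ) / 2) = ((2 * √Real.pi) ^ n)⁻¹ := by
    rw [show 4 * Real.pi = (2 * √Real.pi) ^ (2 : ℝ) by
        rw [Real.rpow_two, mul_pow, Real.sq_sqrt Real.pi_pos.le]; norm_num,
      ← Real.rpow_mul (by positivity), ← Real.rpow_natCast, ← Real.rpow_neg (by positivity)]
    congr 1
    ring
  rw [hpolar, hvol, hconst, setIntegral_Ioo_exp_neg_mul_rpow hn]
  have hG := (Real.Gamma_pos_of_pos hn0).ne'
  have hpi : √Real.pi ≠ 0 := (Real.sqrt_pos.2 Real.pi_pos).ne'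
  have hn1 : (n : ℝ) ≠ 0 := by positivity
  obtain ⟨m, rfl⟩ := Nat.exists_eq_add_of_le' hn
  rw [Nat.add_sub_cancel, mul_pow, one_div_pow, pow_succ 2 m]
  field_simp

/-- Rescaling the ball of radius `ε` to the unit ball. -/
theorem setIntegral_ball_Sfac_mul_Hker (n : ℕ) {ε : ℝ} (hε : 0 < ε) :
    ∫ y in ball (0 : En n) ε, Sfac n (ε ^ 2) * Hker n (ε ^ 2) y =
      (2 * Real.pi * (Real.sinh (2 * ε ^ 2) / ε ^ 2)) ^ (-(n : ℝ) / 2) *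
        ∫ z in ball (0 : En n) 1, Real.exp (-(‖z‖ ^ 2 / 4) * (ε ^ 2 * coth (ε ^ 2))) := by
  have hscale := Measure.setIntegral_comp_smul_of_pos (volume : Measure (En n))
    (Hker n (ε ^ 2)) (ball 0 1) hε
  rw [smul_unitBall_of_pos hε, finrank_euclideanSpace, Fintype.card_fin, smul_eq_mul] at hscale
  have hint : ∫ z in ball (0 : En n) 1, Real.exp (-(‖z‖ ^ 2 / 4) * (ε ^ 2 * coth (ε ^ 2))) =
      ∫ z in ball (0 : En n) 1, Hker n (ε ^ 2) (ε • z) := by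
    congr with z
    rw [Hker, norm_smul, Real.norm_of_nonneg hε.le]
    ring_nf
  have hsinh : 0 < Real.sinh (2 * ε ^ 2) := Real.sinh_pos_iff.2 (by positivity)
  have hpow : (ε ^ 2) ^ (-(n : ℝ) / 2) = (ε ^ n)⁻¹ := by
    rw [← Real.rpow_two, ← Real.rpow_mul hε.le, ← Real.rpow_natCast, ← Real.rpow_neg hε.le]
    congr 1
    ring
  rw [integral_const_mul, hint, hscale, ← mul_div_assoc,
    Real.div_rpow (by positivity) (by positivity), hpow, Sfac]
  field_simp

/-- `sinh (c x) / x → c` as `x → 0`. -/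
theorem tendsto_sinh_const_mul_div (c : ℝ) :
    Tendsto (fun x : ℝ => Real.sinh (c * x) / x) (𝓝[≠] 0) (𝓝 c) := by
  have h : HasDerivAt (fun x : ℝ => Real.sinh (c * x)) c 0 := by
    simpa using ((hasDerivAt_id (0 : ℝ)).const_mul c).sinh
  simpa [div_eq_inv_mul] using h.tendsto_slope_zero

/-- `x coth x → 1` as `x → 0`. -/
theorem tendsto_mul_coth : Tendsto (fun x : ℝ => x * coth x) (𝓝[≠] 0) (𝓝 1) := by
  have hsinh : Tendsto (fun x : ℝ => Real.sinh x / x) (𝓝[≠] 0) (𝓝 1) := by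
    simpa using tendsto_sinh_const_mul_div 1
  have hcosh : Tendsto Real.cosh (𝓝[≠] 0) (𝓝 1) := by
    simpa using (Real.continuous_cosh.tendsto 0).mono_left nhdsWithin_le_nhds
  have h := hcosh.div hsinh one_ne_zero
  rw [div_one] at h
  refine h.congr fun x => ?_
  rw [Pi.div_apply, coth, div_div_eq_mul_div]
  ring

/-- `∫_{|y|<ε} S(ε²) H(ε²,y) dy → (1/Γ(n/2)) ∫₀^{1/4} e^{-u} u^{n/2-1} du`
as `ε → 0⁺`. -/
theorem mehler_ball_limit (n : ℕ) (hn : 1 ≤ n) :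
    Tendsto
      (fun ε : ℝ => ∫ y in Metric.ball (0 : En n) ε, Sfac n (ε ^ 2) * Hker n (ε ^ 2) y)
      (𝓝[>] 0)
      (𝓝 ((1 / Real.Gamma ((n : ℝ) / 2)) *
          ∫ u in Set.Ioo (0 : ℝ) (1 / 4 : ℝ), Real.exp (-u) * u ^ ((n : ℝ) / 2 - 1))) := by
  rw [← setIntegral_ball_exp_neg_norm_sq_div_four hn]
  have hsq : Tendsto (fun ε : ℝ => ε ^ 2) (𝓝[>] 0) (𝓝[≠] 0) := by
    refine tendsto_nhdsWithin_iff.2 ⟨?_, ?_⟩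
    · simpa using ((continuous_pow 2).tendsto (0 : ℝ)).mono_left nhdsWithin_le_nhds
    · filter_upwards [self_mem_nhdsWithin] with ε hε
      exact pow_ne_zero 2 (ne_of_gt hε)
  have hcoth : Tendsto (fun ε : ℝ => ε ^ 2 * coth (ε ^ 2)) (𝓝[>] 0) (𝓝 1) :=
    tendsto_mul_coth.comp hsq
  have hpre : Tendsto
      (fun ε : ℝ => (2 * Real.pi * (Real.sinh (2 * ε ^ 2) / ε ^ 2)) ^ (-(n : ℝ) / 2))
      (𝓝[>] 0) (𝓝 ((4 * Real.pi) ^ (-(n : ℝ) / 2))) := by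
    rw [show 4 * Real.pi = 2 * Real.pi * 2 by ring]
    exact (((tendsto_sinh_const_mul_div 2).comp hsq).const_mul _).rpow_const
      (Or.inl (by positivity))
  have hint : Tendsto
      (fun ε : ℝ => ∫ z in ball (0 : En n) 1,
        Real.exp (-(‖z‖ ^ 2 / 4) * (ε ^ 2 * coth (ε ^ 2))))
      (𝓝[>] 0) (𝓝 (∫ z in ball (0 : En n) 1, Real.exp (-(‖z‖ ^ 2 / 4)))) := by
    refine tendsto_integral_filter_of_dominated_convergence (fun _ => 1) ?_ ?_ ?_ ?_
    · exact Eventually.of_forall fun ε => Continuous.aestronglyMeasurable (by fun_prop)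
    · filter_upwards [hcoth.eventually_const_le zero_lt_one] with ε hε
      refine Eventually.of_forall fun z => ?_
      rw [Real.norm_of_nonneg (Real.exp_pos _).le, Real.exp_le_one_iff]
      exact mul_nonpos_of_nonpos_of_nonneg (by simp only [Left.neg_nonpos_iff]; positivity) hε
    · exact integrableOn_const measure_ball_lt_top.ne
    · refine Eventually.of_forall fun z => ?_
      simpa using (hcoth.const_mul (-(‖z‖ ^ 2 / 4))).rexp
  refine (hpre.mul hint).congr' ?_
  filter_upwards [self_mem_nhdsWithin] with ε hε
  exact (setIntegral_ball_Sfac_mul_Hker n hε).symm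
end
end

section
/- Let n ≥ 1 and let f : ℝ^{n+1} → ℝ be bounded and compactly supported. Then for every (t,x) ∈ ℝ × ℝⁿ the integral u(t,x) = ∫₀^∞ ∫_{ℝⁿ} 𝒲_τ(x,y) f(t−τ, y) dy dτ is absolutely convergent. If moreover f is of class C², then u is a classical solution of the harmonic oscillator evolution equation ∂_t u = Δu − |x|² u + f on ℝ^{n+1}. -/
open MeasureTheory Filter Set Metric
open scoped ENNReal NNReal Topology

noncomputable section

/-- The Mehler kernel
`𝒲_τ(x,y) = (2π sinh 2τ)^{-n/2} exp(-(1/4)(|x-y|² coth τ + |x+y|² tanh τ))`,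
extended by `0` for `τ ≤ 0`. -/
def Mehler (n : ℕ) (τ : ℝ) (x y : En n) : ℝ :=
  if 0 < τ then
    (2 * Real.pi * Real.sinh (2 * τ)) ^ (-(n : ℝ) / 2) *
      Real.exp (-(1 / 4) * (‖x - y‖ ^ 2 * coth τ + ‖x + y‖ ^ 2 * Real.tanh τ))
  else 0

/-- Laplacian of `g : ℝⁿ → ℝ`. -/
def lap {n : ℕ} (g : En n → ℝ) (x : En n) : ℝ :=
  ∑ i : Fin n, pd i (pd i g) x

/-- `∂_{y_i y_j} 𝒲_τ(x,y)` (second partial derivative in the `y` variables). -/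
def Mij (n : ℕ) (i j : Fin n) (τ : ℝ) (x y : En n) : ℝ :=
  pd i (pd j (Mehler n τ x)) y

/-- `∂_τ 𝒲_τ(x,y)`. -/
def Mt (n : ℕ) (τ : ℝ) (x y : En n) : ℝ :=
  deriv (fun σ => Mehler n σ x y) τ

/-- The truncation region `Ω_ε(x) ∩ {τ > 0} = {(τ,y) : τ > 0, max(|τ|^{1/2}, |x-y|) > ε}`. -/
def OmegaX (n : ℕ) (ε : ℝ) (x : En n) : Set (ℝ × En n) :=
  {p | 0 < p.1 ∧ ε < max (Real.sqrt |p.1|) ‖x - p.2‖}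

/-- `A_n = (1/(n Γ(n/2))) ∫_{1/4}^∞ u^{n/2-1} e^{-u} du`. -/
def An (n : ℕ) : ℝ :=
  (1 / (n * Real.Gamma ((n : ℝ) / 2))) *
    ∫ u in Set.Ioi (1 / 4 : ℝ), u ^ ((n : ℝ) / 2 - 1) * Real.exp (-u)

/-- `B_n = (1/Γ(n/2)) ∫_0^{1/4} u^{n/2-1} e^{-u} du`. -/
def Bn (n : ℕ) : ℝ :=
  (1 / Real.Gamma ((n : ℝ) / 2)) *
    ∫ u in Set.Ioo (0 : ℝ) (1 / 4 : ℝ), u ^ ((n : ℝ) / 2 - 1) * Real.exp (-u)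

/-- The rescaling factor `sech 2τ`. -/
def sech2 (τ : ℝ) : ℝ := (Real.cosh (2 * τ))⁻¹

/-- The variance `tanh 2τ`. -/
def tanh2 (τ : ℝ) : ℝ := Real.sinh (2 * τ) / Real.cosh (2 * τ)

/-- The standard Gaussian density on `ℝⁿ`. -/
def gaussDensity (n : ℕ) (z : En n) : ℝ :=
  (2 * Real.pi) ^ (-(n : ℝ) / 2) * Real.exp (-(1 / 2) * ‖z‖ ^ 2)

/-- The time weight `(cosh 2τ)^{-n/2}`. -/
def timeDensity (n : ℕ) (τ : ℝ) : ℝ := Real.cosh (2 * τ) ^ (-(n : ℝ) / 2)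

/-- The standard Gaussian measure on `ℝⁿ`. -/
def gaussMeasure (n : ℕ) : Measure (En n) :=
  volume.withDensity fun z => ENNReal.ofReal (gaussDensity n z)

/-- The measure `(cosh 2τ)^{-n/2} dτ` on the positive half-line. -/
def timeMeasure (n : ℕ) : Measure ℝ :=
  (volume.restrict (Ioi 0)).withDensity fun τ => ENNReal.ofReal (timeDensity n τ)

lemma sech2_pos (τ : ℝ) : 0 < sech2 τ := inv_pos.2 (Real.cosh_pos _)

lemma sech2_le_one (τ : ℝ) : sech2 τ ≤ 1 := inv_le_one_of_one_le₀ (Real.one_le_cosh _)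

lemma tanh2_pos {τ : ℝ} (h : 0 < τ) : 0 < tanh2 τ :=
  div_pos (Real.sinh_pos_iff.2 (by linarith)) (Real.cosh_pos _)

lemma tanh2_le_one (τ : ℝ) : tanh2 τ ≤ 1 := by
  rw [tanh2, div_le_one (Real.cosh_pos _)]
  exact (Real.sinh_lt_cosh _).le

lemma tanh2_sq (τ : ℝ) : tanh2 τ ^ 2 = 1 - sech2 τ ^ 2 := by
  have h := (Real.cosh_pos (2 * τ)).ne'
  rw [tanh2, sech2]
  field_simp
  rw [Real.sinh_sq]

lemma continuous_sech2 : Continuous sech2 :=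
  (Real.continuous_cosh.comp (by fun_prop)).inv₀ fun _ => (Real.cosh_pos _).ne'

lemma continuous_tanh2 : Continuous tanh2 :=
  (Real.continuous_sinh.comp (by fun_prop)).div (Real.continuous_cosh.comp (by fun_prop))
    fun _ => (Real.cosh_pos _).ne'

lemma hasDerivAt_cosh_two_mul (τ : ℝ) :
    HasDerivAt (fun τ => Real.cosh (2 * τ)) (2 * Real.sinh (2 * τ)) τ := by
  have := (Real.hasDerivAt_cosh (2 * τ)).comp τ ((hasDerivAt_id τ).const_mul 2)
  exact this.congr_deriv (by ring)

lemma hasDerivAt_sinh_two_mul (τ : ℝ) :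
    HasDerivAt (fun τ => Real.sinh (2 * τ)) (2 * Real.cosh (2 * τ)) τ := by
  have := (Real.hasDerivAt_sinh (2 * τ)).comp τ ((hasDerivAt_id τ).const_mul 2)
  exact this.congr_deriv (by ring)

lemma hasDerivAt_sech2 (τ : ℝ) : HasDerivAt sech2 (-2 * sech2 τ * tanh2 τ) τ := by
  have h := (Real.cosh_pos (2 * τ)).ne'
  refine ((hasDerivAt_cosh_two_mul τ).inv h).congr_deriv ?_
  rw [sech2, tanh2]
  field_simp

lemma hasDerivAt_tanh2 (τ : ℝ) : HasDerivAt tanh2 (2 * sech2 τ ^ 2) τ := by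
  have h := (Real.cosh_pos (2 * τ)).ne'
  refine ((hasDerivAt_sinh_two_mul τ).div (hasDerivAt_cosh_two_mul τ) h).congr_deriv ?_
  rw [sech2]
  field_simp
  rw [Real.sinh_sq]
  ring

lemma timeDensity_pos (n : ℕ) (τ : ℝ) : 0 < timeDensity n τ :=
  Real.rpow_pos_of_pos (Real.cosh_pos _) _

lemma continuous_timeDensity (n : ℕ) : Continuous (timeDensity n) :=
  (Real.continuous_cosh.comp (by fun_prop)).rpow_const fun _ => Or.inl (Real.cosh_pos _).ne'

lemma hasDerivAt_timeDensity (n : ℕ) (τ : ℝ) :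
    HasDerivAt (timeDensity n) (-n * tanh2 τ * timeDensity n τ) τ := by
  have h := (Real.cosh_pos (2 * τ))
  refine ((hasDerivAt_cosh_two_mul τ).rpow_const (p := -(n : ℝ) / 2)
    (Or.inl h.ne')).congr_deriv ?_
  rw [tanh2, timeDensity, Real.rpow_sub_one h.ne']
  field_simp

lemma timeDensity_le (n : ℕ) (τ : ℝ) :
    timeDensity n τ ≤ 2 ^ ((n : ℝ) / 2) * Real.exp (-n * τ) := by
  have h : Real.exp (2 * τ) / 2 ≤ Real.cosh (2 * τ) := by
    rw [Real.cosh_eq]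
    linarith [Real.exp_pos (-(2 * τ))]
  have hp : 0 < Real.exp (2 * τ) / 2 := by positivity
  calc timeDensity n τ ≤ (Real.exp (2 * τ) / 2) ^ (-(n : ℝ) / 2) :=
        Real.rpow_le_rpow_of_nonpos hp h (by rw [neg_div]; simp; positivity)
    _ = 2 ^ ((n : ℝ) / 2) * Real.exp (-n * τ) := by
        rw [Real.div_rpow (Real.exp_pos _).le (by norm_num), ← Real.exp_mul, neg_div,
          Real.rpow_neg (by norm_num), div_inv_eq_mul, mul_comm]
        congr 2
        ring

lemma integrableOn_timeDensity {n : ℕ} (hn : 1 ≤ n) : IntegrableOn (timeDensity n) (Ioi 0) := by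
  have h : (0 : ℝ) < n := by exact_mod_cast hn
  refine Integrable.mono' ((exp_neg_integrableOn_Ioi 0 h).const_mul (2 ^ ((n : ℝ) / 2)))
    (continuous_timeDensity n).aestronglyMeasurable (ae_of_all _ fun τ => ?_)
  rw [Real.norm_of_nonneg (timeDensity_pos n τ).le]
  exact timeDensity_le n τ

lemma tendsto_timeDensity {n : ℕ} (hn : 1 ≤ n) : Tendsto (timeDensity n) atTop (𝓝 0) := by
  have h : (0 : ℝ) < n := by exact_mod_cast hn
  have h1 : Tendsto (fun τ : ℝ => 2 ^ ((n : ℝ) / 2) * Real.exp (-n * τ)) atTop (𝓝 0) := by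
    have := (Real.tendsto_exp_neg_atTop_nhds_zero.comp
      (tendsto_id.const_mul_atTop h)).const_mul ((2 : ℝ) ^ ((n : ℝ) / 2))
    simpa [Function.comp_def] using this
  exact squeeze_zero (fun τ => (timeDensity_pos n τ).le) (timeDensity_le n) h1

lemma gaussDensity_pos (n : ℕ) (z : En n) : 0 < gaussDensity n z := by
  unfold gaussDensity
  positivity

lemma continuous_gaussDensity (n : ℕ) : Continuous (gaussDensity n) := by
  unfold gaussDensity
  fun_prop

lemma integral_gaussDensity (n : ℕ) : ∫ z, gaussDensity n z = 1 := by
  simp only [gaussDensity]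
  rw [integral_const_mul, GaussianFourier.integral_rexp_neg_mul_sq_norm (by norm_num),
    finrank_euclideanSpace_fin, show Real.pi / (1 / 2) = 2 * Real.pi by ring,
    ← Real.rpow_add (by positivity)]
  rw [show -(n : ℝ) / 2 + n / 2 = 0 by ring, Real.rpow_zero]

lemma integrable_gaussDensity (n : ℕ) : Integrable (gaussDensity n) :=
  Integrable.of_integral_ne_zero (by rw [integral_gaussDensity]; norm_num)

instance (n : ℕ) : IsFiniteMeasure (gaussMeasure n) :=
  isFiniteMeasure_withDensity_ofReal (integrable_gaussDensity n).2

lemma isFiniteMeasure_timeMeasure {n : ℕ} (hn : 1 ≤ n) : IsFiniteMeasure (timeMeasure n) :=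
  isFiniteMeasure_withDensity_ofReal (integrableOn_timeDensity hn).2

lemma integral_gaussMeasure {n : ℕ} (g : En n → ℝ) :
    ∫ z, g z ∂gaussMeasure n = ∫ z, gaussDensity n z * g z := by
  rw [gaussMeasure, integral_withDensity_eq_integral_toReal_smul
    (continuous_gaussDensity n).measurable.ennreal_ofReal (by simp)]
  simp only [ENNReal.toReal_ofReal (gaussDensity_pos n _).le, smul_eq_mul]

lemma integrable_gaussMeasure {n : ℕ} {g : En n → ℝ} :
    Integrable g (gaussMeasure n) ↔ Integrable fun z => gaussDensity n z * g z := by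
  rw [gaussMeasure, integrable_withDensity_iff_integrable_smul'
    (continuous_gaussDensity n).measurable.ennreal_ofReal (by simp)]
  simp only [ENNReal.toReal_ofReal (gaussDensity_pos n _).le, smul_eq_mul]

lemma integral_timeMeasure {n : ℕ} (g : ℝ → ℝ) :
    ∫ τ, g τ ∂timeMeasure n = ∫ τ in Ioi 0, timeDensity n τ * g τ := by
  rw [timeMeasure, integral_withDensity_eq_integral_toReal_smul
    (continuous_timeDensity n).measurable.ennreal_ofReal (by simp)]
  simp only [ENNReal.toReal_ofReal (timeDensity_pos n _).le, smul_eq_mul]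

lemma integrable_timeMeasure {n : ℕ} {g : ℝ → ℝ} :
    Integrable g (timeMeasure n) ↔ IntegrableOn (fun τ => timeDensity n τ * g τ) (Ioi 0) := by
  rw [timeMeasure, integrable_withDensity_iff_integrable_smul'
    (continuous_timeDensity n).measurable.ennreal_ofReal (by simp), IntegrableOn]
  simp only [ENNReal.toReal_ofReal (timeDensity_pos n _).le, smul_eq_mul]

lemma Mehler_nonneg (n : ℕ) (τ : ℝ) (x y : En n) : 0 ≤ Mehler n τ x y := by
  unfold Mehler
  split_ifs with h
  · have := Real.sinh_pos_iff.2 (show 0 < 2 * τ by linarith)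
    positivity
  · rfl

lemma Mehler_eq_zero {n : ℕ} {τ : ℝ} (h : τ ≤ 0) (x y : En n) : Mehler n τ x y = 0 :=
  if_neg h.not_gt

lemma Mehler_exponent {τ : ℝ} (hτ : 0 < τ) {n : ℕ} (x z : En n) :
    -(1 / 4) * (‖x - (sech2 τ • x + √(tanh2 τ) • z)‖ ^ 2 * coth τ
      + ‖x + (sech2 τ • x + √(tanh2 τ) • z)‖ ^ 2 * Real.tanh τ)
    = -(tanh2 τ / 2 * ‖x‖ ^ 2) + -(1 / 2) * ‖z‖ ^ 2 := by
  have hs : Real.sinh τ ≠ 0 := (Real.sinh_pos_iff.2 hτ).ne'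
  have hc : Real.cosh τ ≠ 0 := (Real.cosh_pos τ).ne'
  have hC : Real.cosh τ ^ 2 + Real.sinh τ ^ 2 ≠ 0 := by positivity
  have hr : √(tanh2 τ) ^ 2 = tanh2 τ := Real.sq_sqrt (tanh2_pos hτ).le
  set r := √(tanh2 τ)
  have hy : ‖sech2 τ • x + r • z‖ ^ 2
      = sech2 τ ^ 2 * ‖x‖ ^ 2 + 2 * sech2 τ * r * inner ℝ x z + tanh2 τ * ‖z‖ ^ 2 := by
    rw [norm_add_sq_real, norm_smul, norm_smul, inner_smul_left, inner_smul_right, mul_pow, mul_pow,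
      Real.norm_eq_abs, Real.norm_eq_abs, sq_abs, sq_abs, hr]
    simp
    ring
  have hi : inner ℝ x (sech2 τ • x + r • z) = sech2 τ * ‖x‖ ^ 2 + r * inner ℝ x z := by
    rw [inner_add_right, inner_smul_right, inner_smul_right, real_inner_self_eq_norm_sq]
  rw [norm_sub_sq_real x, norm_add_sq_real x, hy, hi]
  simp only [sech2, tanh2, coth, Real.tanh_eq_sinh_div_cosh, Real.cosh_two_mul, Real.sinh_two_mul]
  have h1 := Real.cosh_sq τ
  have h2 : Real.cosh τ ^ 4 = (Real.sinh τ ^ 2 + 1) ^ 2 := by rw [← h1]; ring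
  have h3 : Real.cosh τ ^ 6 = (Real.sinh τ ^ 2 + 1) ^ 3 := by rw [← h1]; ring
  field_simp
  generalize Real.cosh τ = c at *
  generalize Real.sinh τ = s at *
  ring_nf
  simp only [h1, h2, h3]
  ring

lemma sqrt_tanh2_pow_mul {n : ℕ} {τ : ℝ} (hτ : 0 < τ) :
    √(tanh2 τ) ^ n * (2 * Real.pi * Real.sinh (2 * τ)) ^ (-(n : ℝ) / 2)
      = timeDensity n τ * (2 * Real.pi) ^ (-(n : ℝ) / 2) := by
  have hs : 0 < Real.sinh (2 * τ) := Real.sinh_pos_iff.2 (by linarith)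
  have hc := Real.cosh_pos (2 * τ)
  have h1 : √(tanh2 τ) ^ n = tanh2 τ ^ ((n : ℝ) / 2) := by
    rw [Real.sqrt_eq_rpow, ← Real.rpow_mul_natCast (tanh2_pos hτ).le]
    congr 1
    ring
  rw [h1, timeDensity, tanh2, Real.div_rpow hs.le hc.le, Real.mul_rpow (by positivity) hs.le,
    neg_div, Real.rpow_neg hs.le, Real.rpow_neg hc.le]
  have := (Real.rpow_pos_of_pos hs ((n : ℝ) / 2)).ne'
  have := (Real.rpow_pos_of_pos hc ((n : ℝ) / 2)).ne'
  field_simp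

lemma Mehler_scaled {n : ℕ} {τ : ℝ} (hτ : 0 < τ) (x z : En n) :
    √(tanh2 τ) ^ n * Mehler n τ x (sech2 τ • x + √(tanh2 τ) • z)
      = timeDensity n τ * Real.exp (-(tanh2 τ / 2 * ‖x‖ ^ 2)) * gaussDensity n z := by
  rw [Mehler, if_pos hτ, Mehler_exponent hτ, ← mul_assoc, sqrt_tanh2_pow_mul hτ, Real.exp_add,
    gaussDensity]
  ring

/-- The substitution `y = x sech 2τ + z √(tanh 2τ)` turns the Mehler kernel into a Gaussian. -/
lemma integral_Mehler_mul {n : ℕ} {τ : ℝ} (hτ : 0 < τ) (x : En n) (g : En n → ℝ) :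
    ∫ y, Mehler n τ x y * g y = timeDensity n τ * ∫ z, Real.exp (-(tanh2 τ / 2 * ‖x‖ ^ 2)) *
      g (sech2 τ • x + √(tanh2 τ) • z) ∂gaussMeasure n := by
  have hr : 0 < √(tanh2 τ) ^ n := pow_pos (Real.sqrt_pos.2 (tanh2_pos hτ)) n
  have h := Measure.integral_comp_smul volume
    (fun y : En n => Mehler n τ x (sech2 τ • x + y) * g (sech2 τ • x + y)) (√(tanh2 τ))
  rw [integral_add_left_eq_self (fun y => Mehler n τ x y * g y), finrank_euclideanSpace_fin,
    abs_of_pos (inv_pos.2 hr), smul_eq_mul, eq_inv_mul_iff_mul_eq₀ hr.ne'] at h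
  rw [← h, integral_gaussMeasure, ← integral_const_mul, ← integral_const_mul]
  congr 1
  ext z
  rw [← mul_assoc, Mehler_scaled hτ]
  ring

lemma integral_Mehler {n : ℕ} {τ : ℝ} (hτ : 0 < τ) (x : En n) :
    ∫ y, Mehler n τ x y = timeDensity n τ * Real.exp (-(tanh2 τ / 2 * ‖x‖ ^ 2)) := by
  have := integral_Mehler_mul hτ x (fun _ => 1)
  rw [integral_gaussMeasure] at this
  simp only [mul_one] at this
  rw [this, integral_mul_const, integral_gaussDensity, one_mul]

lemma integrable_Mehler_right {n : ℕ} (τ : ℝ) (x : En n) : Integrable (Mehler n τ x) := by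
  rcases le_or_gt τ 0 with h | h
  · simp only [funext (Mehler_eq_zero h x)]
    exact integrable_zero _ _ _
  · refine Integrable.of_integral_ne_zero ?_
    rw [integral_Mehler h]
    exact (mul_pos (timeDensity_pos n τ) (Real.exp_pos _)).ne'

lemma measurable_Mehler {n : ℕ} (x : En n) :
    Measurable fun p : ℝ × En n => Mehler n p.1 x p.2 := by
  unfold Mehler coth
  simp only [Real.tanh_eq_sinh_div_cosh]
  refine Measurable.ite (measurableSet_lt measurable_const measurable_fst) ?_ measurable_const
  fun_prop

lemma integrable_Mehler {n : ℕ} (hn : 1 ≤ n) (x : En n) :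
    Integrable fun p : ℝ × En n => Mehler n p.1 x p.2 := by
  rw [Measure.volume_eq_prod, integrable_prod_iff (measurable_Mehler x).aestronglyMeasurable]
  refine ⟨ae_of_all _ fun τ => integrable_Mehler_right τ x, ?_⟩
  simp only [Real.norm_of_nonneg (Mehler_nonneg n _ x _)]
  refine Integrable.mono' (g := (Ioi 0).indicator (timeDensity n))
    ((integrableOn_timeDensity hn).integrable_indicator measurableSet_Ioi)
    (measurable_Mehler x).stronglyMeasurable.integral_prod_right'.aestronglyMeasurable
    (ae_of_all _ fun τ => ?_)
  rcases le_or_gt τ 0 with h | h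
  · simp [Mehler_eq_zero h, h]
  · rw [integral_Mehler h, indicator_of_mem (mem_Ioi.2 h),
      Real.norm_of_nonneg (mul_pos (timeDensity_pos n τ) (Real.exp_pos _)).le]
    refine mul_le_of_le_one_right (timeDensity_pos n τ).le (Real.exp_le_one_iff.2 ?_)
    have := tanh2_pos h
    simp only [Left.neg_nonpos_iff]
    positivity

lemma integrable_Mehler_mul {n : ℕ} (hn : 1 ≤ n) {f : ℝ × En n → ℝ} {M : ℝ}
    (hM : ∀ z, |f z| ≤ M) (hfm : Measurable f) (t : ℝ) (x : En n) :
    Integrable fun p : ℝ × En n => Mehler n p.1 x p.2 * f (t - p.1, p.2) :=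
  (integrable_Mehler hn x).mul_bdd (c := M)
    (hfm.comp (by fun_prop)).aestronglyMeasurable (ae_of_all _ fun p => hM _)

lemma ae_fst_pos (n : ℕ) :
    ∀ᵐ p : ℝ × En n ∂(timeMeasure n).prod (gaussMeasure n), 0 < p.1 := by
  have h : ∀ᵐ τ ∂timeMeasure n, 0 < τ :=
    (withDensity_absolutelyContinuous _ _).ae_le (ae_restrict_mem measurableSet_Ioi)
  exact Measure.quasiMeasurePreserving_fst.ae h

/-- The Mehler potential as an integral against a fixed finite measure. -/
lemma integral_Mehler_prod {n : ℕ} (hn : 1 ≤ n) {f : ℝ × En n → ℝ} {M : ℝ}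
    (hM : ∀ z, |f z| ≤ M) (hfc : Continuous f) (t : ℝ) (x : En n) :
    ∫ p : ℝ × En n, Mehler n p.1 x p.2 * f (t - p.1, p.2)
      = ∫ p, Real.exp (-(tanh2 p.1 / 2 * ‖x‖ ^ 2)) *
          f (t - p.1, sech2 p.1 • x + √(tanh2 p.1) • p.2)
            ∂(timeMeasure n).prod (gaussMeasure n) := by
  have := isFiniteMeasure_timeMeasure hn
  have hc : Continuous fun p : ℝ × En n => Real.exp (-(tanh2 p.1 / 2 * ‖x‖ ^ 2)) *
      f (t - p.1, sech2 p.1 • x + √(tanh2 p.1) • p.2) := by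
    have := continuous_tanh2
    have := continuous_sech2
    fun_prop
  have hi : Integrable (fun p : ℝ × En n => Real.exp (-(tanh2 p.1 / 2 * ‖x‖ ^ 2)) *
      f (t - p.1, sech2 p.1 • x + √(tanh2 p.1) • p.2))
      ((timeMeasure n).prod (gaussMeasure n)) := by
    refine (integrable_const M).mono' hc.aestronglyMeasurable ?_
    filter_upwards [ae_fst_pos n] with p hp
    rw [norm_mul, Real.norm_eq_abs, Real.norm_eq_abs, Real.abs_exp]
    refine (mul_le_of_le_one_left (abs_nonneg _) (Real.exp_le_one_iff.2 ?_)).trans (hM _)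
    have := tanh2_pos hp
    simp only [Left.neg_nonpos_iff]
    positivity
  rw [Measure.volume_eq_prod, integral_prod _ (integrable_Mehler_mul hn hM hfc.measurable t x),
    integral_prod _ hi, integral_timeMeasure]
  rw [← setIntegral_eq_integral_of_forall_compl_eq_zero (s := Ioi 0)]
  · refine setIntegral_congr_fun measurableSet_Ioi fun τ hτ => ?_
    exact integral_Mehler_mul hτ x fun y => f (t - τ, y)
  · intro τ hτ
    simp [Mehler_eq_zero (not_lt.1 hτ)]

section ParametricIntegral

variable {E V Ω : Type*} [NormedAddCommGroup E] [NormedSpace ℝ E]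
  [NormedAddCommGroup V] [NormedSpace ℝ V] [TopologicalSpace Ω] [SecondCountableTopology Ω]
  [MeasurableSpace Ω] [OpensMeasurableSpace Ω] {μ : Measure Ω} [IsFiniteMeasure μ]

omit [NormedSpace ℝ E] in
lemma continuous_integral_of_locally_bounded {F : E → Ω → V}
    (hF : Continuous (Function.uncurry F))
    (hb : ∀ R : ℝ, ∃ C : ℝ, ∀ᵐ ω ∂μ, ∀ x, ‖x‖ ≤ R → ‖F x ω‖ ≤ C) :
    Continuous fun x => ∫ ω, F x ω ∂μ := by
  refine continuous_iff_continuousAt.2 fun x₀ => ?_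
  obtain ⟨C, hC⟩ := hb (‖x₀‖ + 1)
  have hx : ∀ᶠ x in 𝓝 x₀, ‖x‖ ≤ ‖x₀‖ + 1 :=
    (continuous_norm.tendsto x₀).eventually_le_const (lt_add_one _)
  refine continuousAt_of_dominated (bound := fun _ => C) (Eventually.of_forall fun x => ?_) ?_
    (integrable_const C) (ae_of_all _ fun ω => ?_)
  · exact (hF.comp (by fun_prop : Continuous fun ω => (x, ω))).aestronglyMeasurable
  · filter_upwards [hx] with x hx
    filter_upwards [hC] with ω hω using hω x hx
  · exact (hF.comp (by fun_prop : Continuous fun x => (x, ω))).continuousAt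

lemma hasFDerivAt_integral_of_locally_bounded {F : E → Ω → V} {F' : E → Ω → E →L[ℝ] V}
    (hF : Continuous (Function.uncurry F)) (hF' : Continuous (Function.uncurry F'))
    (hd : ∀ x ω, HasFDerivAt (fun x => F x ω) (F' x ω) x)
    (hb : ∀ R : ℝ, ∃ C : ℝ, ∀ᵐ ω ∂μ, ∀ x, ‖x‖ ≤ R → ‖F x ω‖ ≤ C)
    (hb' : ∀ R : ℝ, ∃ C : ℝ, ∀ᵐ ω ∂μ, ∀ x, ‖x‖ ≤ R → ‖F' x ω‖ ≤ C) (x₀ : E) :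
    HasFDerivAt (fun x => ∫ ω, F x ω ∂μ) (∫ ω, F' x₀ ω ∂μ) x₀ := by
  obtain ⟨C, hC⟩ := hb ‖x₀‖
  obtain ⟨C', hC'⟩ := hb' (‖x₀‖ + 1)
  have hx : ∀ᶠ x in 𝓝 x₀, ‖x‖ ≤ ‖x₀‖ + 1 :=
    (continuous_norm.tendsto x₀).eventually_le_const (lt_add_one _)
  have hm : ∀ x, AEStronglyMeasurable (F x) μ := fun x =>
    (hF.comp (by fun_prop : Continuous fun ω => (x, ω))).aestronglyMeasurable
  refine hasFDerivAt_integral_of_dominated_of_fderiv_le (bound := fun _ => C')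
    (s := {x | ‖x‖ ≤ ‖x₀‖ + 1}) hx (Eventually.of_forall hm)
    ((integrable_const C).mono' (hm x₀) ?_) ?_ ?_ (integrable_const C')
    (ae_of_all _ fun ω x _ => hd x ω)
  · filter_upwards [hC] with ω hω using hω x₀ le_rfl
  · exact (hF'.comp (by fun_prop : Continuous fun ω => (x₀, ω))).aestronglyMeasurable
  · filter_upwards [hC'] with ω hω x hx using hω x hx

end ParametricIntegral

section Integrand

variable {n : ℕ} {f : ℝ × En n → ℝ}

/-- The function `x ↦ exp(-T|x|²/2) f(σ, S x + v)` with parameters `(T, S, σ, v)`. -/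
def oscIntegrand (f : ℝ × En n → ℝ) (p : ℝ × ℝ × ℝ × En n) (x : En n) : ℝ :=
  Real.exp (-(p.1 / 2 * ‖x‖ ^ 2)) * f (p.2.2.1, p.2.1 • x + p.2.2.2)

/-- The parameters `(tanh 2τ, sech 2τ, t - τ, z √(tanh 2τ))`. -/
def oscParam (t : ℝ) (ω : ℝ × En n) : ℝ × ℝ × ℝ × En n :=
  (tanh2 ω.1, sech2 ω.1, t - ω.1, √(tanh2 ω.1) • ω.2)

lemma continuous_oscParam (t : ℝ) : Continuous (oscParam (n := n) t) := by
  have := continuous_tanh2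
  have := continuous_sech2
  unfold oscParam
  fun_prop

lemma contDiff_oscIntegrand {k : WithTop ℕ∞} (hf : ContDiff ℝ k f) :
    ContDiff ℝ k (Function.uncurry (oscIntegrand f)) := by
  unfold oscIntegrand Function.uncurry
  have h1 : ContDiff ℝ k fun a : (ℝ × ℝ × ℝ × En n) × En n => ‖a.2‖ ^ 2 :=
    (contDiff_norm_sq ℝ).comp contDiff_snd
  refine ContDiff.mul (Real.contDiff_exp.comp ?_) (hf.comp ?_) <;> fun_prop

lemma contDiff_fderiv_apply {k m : WithTop ℕ∞} {h : ℝ × ℝ × ℝ × En n → En n → ℝ}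
    (hh : ContDiff ℝ m (Function.uncurry h)) (hk : k + 1 ≤ m) (v : En n) :
    ContDiff ℝ k (Function.uncurry fun p x => fderiv ℝ (h p) x v) := by
  have h : ContDiff ℝ m (Function.uncurry fun (a : (ℝ × ℝ × ℝ × En n) × En n) (x : En n) =>
      h a.1 x) :=
    hh.comp (by fun_prop : ContDiff ℝ m
      fun b : ((ℝ × ℝ × ℝ × En n) × En n) × En n => (b.1.1, b.2))
  exact (ContDiff.fderiv h contDiff_snd hk).clm_apply contDiff_const

lemma oscIntegrand_eventuallyEq_zero {p : ℝ × ℝ × ℝ × En n} {x : En n}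
    (h : (p.2.2.1, p.2.1 • x + p.2.2.2) ∉ tsupport f) : oscIntegrand f p =ᶠ[𝓝 x] 0 := by
  have hc : Continuous fun x : En n => (p.2.2.1, p.2.1 • x + p.2.2.2) := by fun_prop
  filter_upwards [hc.continuousAt.eventually ((isClosed_tsupport f).isOpen_compl.mem_nhds h)]
    with x hx
  simp [oscIntegrand, image_eq_zero_of_notMem_tsupport hx]

/-- A continuous function of `(p, x)` supported where `(σ, S x + v)` lies in a compact set is
bounded for `T, S ∈ [0, 1]` and bounded `x`. -/
lemma exists_bound_of_support {V : Type*} [NormedAddCommGroup V] {K : Set (ℝ × En n)}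
    (hK : IsCompact K) {h : ℝ × ℝ × ℝ × En n → En n → V} (hc : Continuous (Function.uncurry h))
    (h0 : ∀ p x, (p.2.2.1, p.2.1 • x + p.2.2.2) ∉ K → h p x = 0) (R : ℝ) :
    ∃ C : ℝ, ∀ p : ℝ × ℝ × ℝ × En n, p.1 ∈ Icc (0 : ℝ) 1 → p.2.1 ∈ Icc (0 : ℝ) 1 →
      ∀ x, ‖x‖ ≤ R → ‖h p x‖ ≤ C := by
  obtain ⟨A, hA⟩ := hK.isBounded.exists_norm_le
  have hcomp : IsCompact (((Icc (0 : ℝ) 1) ×ˢ (Icc (0 : ℝ) 1) ×ˢ closedBall (0 : ℝ) A ×ˢ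
      closedBall (0 : En n) (A + R)) ×ˢ closedBall (0 : En n) R) :=
    (isCompact_Icc.prod (isCompact_Icc.prod ((isCompact_closedBall _ _).prod
      (isCompact_closedBall _ _)))).prod (isCompact_closedBall _ _)
  obtain ⟨C, hC⟩ := hcomp.exists_bound_of_continuousOn hc.continuousOn
  refine ⟨max C 0, fun p hT hS x hx => ?_⟩
  by_cases hp : (p.2.2.1, p.2.1 • x + p.2.2.2) ∈ K
  · refine (hC (p, x) ⟨⟨hT, hS, ?_, ?_⟩, ?_⟩).trans (le_max_left _ _)
    · exact mem_closedBall_zero_iff.2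
        ((norm_fst_le (p.2.2.1, p.2.1 • x + p.2.2.2)).trans (hA _ hp))
    · refine mem_closedBall_zero_iff.2 ?_
      have h1 : ‖p.2.1 • x + p.2.2.2‖ ≤ A :=
        (norm_snd_le (p.2.2.1, p.2.1 • x + p.2.2.2)).trans (hA _ hp)
      have h2 : ‖p.2.1 • x‖ ≤ R := by
        rw [norm_smul, Real.norm_of_nonneg hS.1]
        exact (mul_le_of_le_one_left (norm_nonneg _) hS.2).trans hx
      calc ‖p.2.2.2‖ = ‖(p.2.1 • x + p.2.2.2) - p.2.1 • x‖ := by rw [add_sub_cancel_left]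
        _ ≤ _ := (norm_sub_le _ _).trans (add_le_add h1 h2)
    · exact mem_closedBall_zero_iff.2 hx
  · rw [h0 p x hp, norm_zero]
    exact le_max_right _ _

lemma exists_ae_bound {V : Type*} [NormedAddCommGroup V] (hfc : HasCompactSupport f)
    {h : ℝ × ℝ × ℝ × En n → En n → V} (hc : Continuous (Function.uncurry h))
    (h0 : ∀ p x, (p.2.2.1, p.2.1 • x + p.2.2.2) ∉ tsupport f → h p x = 0) (t R : ℝ) :
    ∃ C : ℝ, ∀ᵐ ω ∂(timeMeasure n).prod (gaussMeasure n), ∀ x, ‖x‖ ≤ R →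
      ‖h (oscParam t ω) x‖ ≤ C := by
  obtain ⟨C, hC⟩ := exists_bound_of_support hfc hc h0 R
  refine ⟨C, ?_⟩
  filter_upwards [ae_fst_pos n] with ω hω
  exact hC _ ⟨(tanh2_pos hω).le, tanh2_le_one _⟩ ⟨(sech2_pos _).le, sech2_le_one _⟩

/-- Differentiation under the integral sign for integrands with compact support. -/
lemma contDiff_one_integral_oscParam (hn : 1 ≤ n) (hfc : HasCompactSupport f)
    {h : ℝ × ℝ × ℝ × En n → En n → ℝ} (hh : ContDiff ℝ 1 (Function.uncurry h))
    (h0 : ∀ p x, (p.2.2.1, p.2.1 • x + p.2.2.2) ∉ tsupport f → h p =ᶠ[𝓝 x] 0) (t : ℝ) :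
    ContDiff ℝ 1 (fun x => ∫ ω, h (oscParam t ω) x ∂(timeMeasure n).prod (gaussMeasure n)) ∧
    ∀ x v, Integrable (fun ω => fderiv ℝ (h (oscParam t ω)) x v)
        ((timeMeasure n).prod (gaussMeasure n)) ∧
      fderiv ℝ (fun x => ∫ ω, h (oscParam t ω) x ∂(timeMeasure n).prod (gaussMeasure n)) x v
        = ∫ ω, fderiv ℝ (h (oscParam t ω)) x v ∂(timeMeasure n).prod (gaussMeasure n) := by
  have := isFiniteMeasure_timeMeasure hn
  have hq : Continuous fun a : En n × ℝ × En n => (oscParam t a.2, a.1) :=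
    ((continuous_oscParam t).comp continuous_snd).prodMk continuous_fst
  have hh' : Continuous (Function.uncurry fun p x => fderiv ℝ (h p) x) := by
    have h : ContDiff ℝ 1 (Function.uncurry fun (a : (ℝ × ℝ × ℝ × En n) × En n) (x : En n) =>
        h a.1 x) :=
      hh.comp (by fun_prop : ContDiff ℝ 1
        fun b : ((ℝ × ℝ × ℝ × En n) × En n) × En n => (b.1.1, b.2))
    exact (ContDiff.fderiv h (contDiff_snd (n := 0)) (by norm_num)).continuous
  have hb := exists_ae_bound hfc hh.continuous (fun p x hp => (h0 p x hp).eq_of_nhds) t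
  have hb' := exists_ae_bound hfc hh'
    (fun p x hp => by rw [(h0 p x hp).fderiv_eq]; simp) t
  have hd : ∀ x, HasFDerivAt
      (fun x => ∫ ω, h (oscParam t ω) x ∂(timeMeasure n).prod (gaussMeasure n))
      (∫ ω, fderiv ℝ (h (oscParam t ω)) x ∂(timeMeasure n).prod (gaussMeasure n)) x := by
    refine hasFDerivAt_integral_of_locally_bounded (F := fun x ω => h (oscParam t ω) x)
      (F' := fun x ω => fderiv ℝ (h (oscParam t ω)) x) (hh.continuous.comp hq)
      (hh'.comp hq) (fun x ω => ?_) hb hb'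
    have : ContDiff ℝ 1 (h (oscParam t ω)) :=
      hh.comp (by fun_prop : ContDiff ℝ 1 fun x => (oscParam t ω, x))
    exact (this.differentiable (by norm_num) x).hasFDerivAt
  have hi : ∀ x, Integrable (fun ω => fderiv ℝ (h (oscParam t ω)) x)
      ((timeMeasure n).prod (gaussMeasure n)) := fun x => by
    obtain ⟨C, hC⟩ := hb' ‖x‖
    refine (integrable_const C).mono' ?_ (hC.mono fun ω h => h x le_rfl)
    exact (hh'.comp ((continuous_oscParam t).prodMk continuous_const)).aestronglyMeasurable
  refine ⟨contDiff_one_iff_fderiv.2 ⟨fun x => (hd x).differentiableAt, ?_⟩, fun x v =>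
    ⟨(hi x).apply_continuousLinearMap v, ?_⟩⟩
  · rw [funext fun x => (hd x).fderiv]
    exact continuous_integral_of_locally_bounded (F := fun x ω => fderiv ℝ (h (oscParam t ω)) x)
      (hh'.comp hq) hb'
  · rw [(hd x).fderiv, ContinuousLinearMap.integral_apply (hi x)]

/-- The Mehler potential, written as an integral against a fixed finite measure. -/
def potential (f : ℝ × En n → ℝ) (t : ℝ) (x : En n) : ℝ :=
  ∫ ω, oscIntegrand f (oscParam t ω) x ∂(timeMeasure n).prod (gaussMeasure n)

lemma fderiv_oscIntegrand_eventuallyEq_zero {p : ℝ × ℝ × ℝ × En n} {x : En n}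
    (h : (p.2.2.1, p.2.1 • x + p.2.2.2) ∉ tsupport f) (v : En n) :
    (fun x => fderiv ℝ (oscIntegrand f p) x v) =ᶠ[𝓝 x] 0 := by
  filter_upwards [(oscIntegrand_eventuallyEq_zero h).fderiv (𝕜 := ℝ)] with y hy
  simp [hy]

lemma contDiff_potential (hn : 1 ≤ n) (hf : ContDiff ℝ 2 f) (hfc : HasCompactSupport f) (t : ℝ) :
    ContDiff ℝ 2 (potential f t) := by
  obtain ⟨h1, h2⟩ := contDiff_one_integral_oscParam hn hfc
    ((contDiff_oscIntegrand hf).of_le (by norm_num)) (fun p x => oscIntegrand_eventuallyEq_zero) t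
  rw [show (2 : WithTop ℕ∞) = 1 + 1 by norm_num, contDiff_succ_iff_fderiv]
  refine ⟨h1.differentiable (by norm_num), by simp, contDiff_clm_apply_iff.2 fun v => ?_⟩
  unfold potential
  simp only [fun x => (h2 x v).2]
  exact (contDiff_one_integral_oscParam hn hfc
    (contDiff_fderiv_apply (contDiff_oscIntegrand hf) (by norm_num) v)
    (fun p x h => fderiv_oscIntegrand_eventuallyEq_zero h v) t).1

lemma lap_potential (hn : 1 ≤ n) (hf : ContDiff ℝ 2 f) (hfc : HasCompactSupport f) (t : ℝ)
    (x : En n) :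
    Integrable (fun ω => lap (oscIntegrand f (oscParam t ω)) x)
      ((timeMeasure n).prod (gaussMeasure n)) ∧
    lap (potential f t) x = ∫ ω, lap (oscIntegrand f (oscParam t ω)) x
        ∂(timeMeasure n).prod (gaussMeasure n) := by
  have h1 := (contDiff_one_integral_oscParam hn hfc
    ((contDiff_oscIntegrand hf).of_le (by norm_num))
    (fun p x => oscIntegrand_eventuallyEq_zero) t).2
  have h2 := fun v => (contDiff_one_integral_oscParam hn hfc
    (contDiff_fderiv_apply (contDiff_oscIntegrand hf) (by norm_num) v)
    (fun p x h => fderiv_oscIntegrand_eventuallyEq_zero h v) t).2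
  have h3 : ∀ i : Fin n, pd i (potential f t) = fun x => ∫ ω,
      fderiv ℝ (oscIntegrand f (oscParam t ω)) x (EuclideanSpace.single i 1)
        ∂(timeMeasure n).prod (gaussMeasure n) := fun i => funext fun x => (h1 x _).2
  refine ⟨integrable_finsetSum _ fun i _ => (h2 _ x _).1, ?_⟩
  simp only [lap, h3]
  refine Eq.trans ?_ (integral_finsetSum _ fun i _ =>
    (h2 (EuclideanSpace.single i 1) x (EuclideanSpace.single i 1)).1).symm
  exact Finset.sum_congr rfl fun i _ => (h2 _ x _).2

lemma pd_exp_mul_comp {h : En n → ℝ} (hh : Differentiable ℝ h) (i : Fin n) (T S : ℝ) (v x : En n) :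
    pd i (fun x => Real.exp (-(T / 2 * ‖x‖ ^ 2)) * h (S • x + v)) x
      = -T * (x i * (Real.exp (-(T / 2 * ‖x‖ ^ 2)) * h (S • x + v)))
        + S * (Real.exp (-(T / 2 * ‖x‖ ^ 2)) * pd i h (S • x + v)) := by
  have h1 : HasFDerivAt (fun x : En n => Real.exp (-(T / 2 * ‖x‖ ^ 2))) _ x :=
    (((hasStrictFDerivAt_norm_sq x).hasFDerivAt.const_mul (T / 2)).neg).exp
  have h2 : HasFDerivAt (fun x : En n => h (S • x + v)) _ x :=
    (hh (S • x + v)).hasFDerivAt.comp x (((hasFDerivAt_id x).const_smul S).add_const v)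
  rw [pd, (h1.fun_mul h2).fderiv]
  simp [pd, EuclideanSpace.inner_single_right]
  ring

lemma contDiff_pd {k m : WithTop ℕ∞} {h : En n → ℝ} (hh : ContDiff ℝ m h) (hk : k + 1 ≤ m)
    (i : Fin n) : ContDiff ℝ k (pd i h) :=
  (hh.fderiv_right hk).clm_apply contDiff_const

lemma sum_mul_pd (h : En n → ℝ) (y x : En n) : ∑ i, x i * pd i h y = fderiv ℝ h y x := by
  conv_rhs => rw [← (EuclideanSpace.basisFun (Fin n) ℝ).sum_repr x]
  simp [pd]

lemma pd_coord_mul {h : En n → ℝ} (i : Fin n) {x : En n} (hh : DifferentiableAt ℝ h x) :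
    pd i (fun x => x i * h x) x = h x + x i * pd i h x := by
  have h1 : HasFDerivAt (fun x : En n => x i) (EuclideanSpace.proj i : En n →L[ℝ] ℝ) x :=
    (EuclideanSpace.proj i : En n →L[ℝ] ℝ).hasFDerivAt
  rw [pd, (h1.fun_mul hh.hasFDerivAt).fderiv]
  simp [pd]
  ring

lemma pd_linear_combination {F G : En n → ℝ} {x : En n} (hF : DifferentiableAt ℝ F x)
    (hG : DifferentiableAt ℝ G x) {i : Fin n} {a b : ℝ} :
    pd i (fun x => a * F x + b * G x) x = a * pd i F x + b * pd i G x := by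
  rw [pd, ((hF.hasFDerivAt.const_mul a).fun_add (hG.hasFDerivAt.const_mul b)).fderiv]
  simp [pd]

lemma lap_exp_mul_comp {h : En n → ℝ} (hh : ContDiff ℝ 2 h) (T S : ℝ) (v x : En n) :
    lap (fun x => Real.exp (-(T / 2 * ‖x‖ ^ 2)) * h (S • x + v)) x
      = Real.exp (-(T / 2 * ‖x‖ ^ 2)) * ((-n * T + T ^ 2 * ‖x‖ ^ 2) * h (S • x + v)
        - 2 * T * S * fderiv ℝ h (S • x + v) x + S ^ 2 * lap h (S • x + v)) := by
  have hd : Differentiable ℝ h := hh.differentiable (by norm_num)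
  have hp : ∀ i, Differentiable ℝ (pd i h) := fun i =>
    (contDiff_pd (k := 1) hh (by norm_num) i).differentiable (by norm_num)
  have he : Differentiable ℝ fun x : En n => Real.exp (-(T / 2 * ‖x‖ ^ 2)) :=
    (((differentiable_id.norm_sq ℝ).const_mul _).neg).exp
  have hl : Differentiable ℝ fun x : En n => S • x + v := by fun_prop
  have key : ∀ i, pd i (pd i fun x => Real.exp (-(T / 2 * ‖x‖ ^ 2)) * h (S • x + v)) x
      = Real.exp (-(T / 2 * ‖x‖ ^ 2)) * ((-T + T ^ 2 * x i ^ 2) * h (S • x + v)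
        - 2 * T * S * (x i * pd i h (S • x + v)) + S ^ 2 * pd i (pd i h) (S • x + v)) := by
    intro i
    rw [funext fun x => pd_exp_mul_comp hd i T S v x]
    have h1 : DifferentiableAt ℝ
        (fun x : En n => x i * (Real.exp (-(T / 2 * ‖x‖ ^ 2)) * h (S • x + v))) x :=
      ((EuclideanSpace.proj i : En n →L[ℝ] ℝ).differentiableAt).mul (he.mul (hd.comp hl) x)
    have h2 : DifferentiableAt ℝ
        (fun x : En n => Real.exp (-(T / 2 * ‖x‖ ^ 2)) * pd i h (S • x + v)) x :=
      he.mul ((hp i).comp hl) x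
    rw [pd_linear_combination h1 h2, pd_exp_mul_comp (hp i),
      pd_coord_mul (h := fun x => Real.exp (-(T / 2 * ‖x‖ ^ 2)) * h (S • x + v)) i
        (he.mul (hd.comp hl) x), pd_exp_mul_comp hd]
    ring
  have hn : ‖x‖ ^ 2 = ∑ i, x i ^ 2 := EuclideanSpace.real_norm_sq_eq x
  rw [lap, Finset.sum_congr rfl fun i _ => key i, ← Finset.mul_sum, Finset.sum_add_distrib,
    Finset.sum_sub_distrib, ← Finset.sum_mul, Finset.sum_add_distrib, ← Finset.mul_sum,
    ← Finset.mul_sum, ← Finset.mul_sum, sum_mul_pd, ← hn, lap]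
  simp

lemma integrable_norm_gaussMeasure : Integrable (fun z : En n => ‖z‖) (gaussMeasure n) := by
  have hi : Integrable fun z : En n => Real.exp (-(1 / 4) * ‖z‖ ^ 2) := by
    refine Integrable.of_integral_ne_zero ?_
    rw [GaussianFourier.integral_rexp_neg_mul_sq_norm (by norm_num)]
    positivity
  rw [integrable_gaussMeasure]
  refine (hi.const_mul ((2 * Real.pi) ^ (-(n : ℝ) / 2))).mono'
    ((continuous_gaussDensity n).mul continuous_norm).aestronglyMeasurable
    (ae_of_all _ fun z => ?_)
  rw [Real.norm_of_nonneg (mul_nonneg (gaussDensity_pos n z).le (norm_nonneg _)), gaussDensity,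
    mul_assoc]
  refine mul_le_mul_of_nonneg_left ?_ (by positivity)
  have h1 : ‖z‖ ≤ Real.exp (1 / 4 * ‖z‖ ^ 2) := by
    have := Real.add_one_le_exp (1 / 4 * ‖z‖ ^ 2)
    nlinarith [sq_nonneg (‖z‖ / 2 - 1)]
  calc Real.exp (-(1 / 2) * ‖z‖ ^ 2) * ‖z‖
      ≤ Real.exp (-(1 / 2) * ‖z‖ ^ 2) * Real.exp (1 / 4 * ‖z‖ ^ 2) := by gcongr
    _ = _ := by rw [← Real.exp_add]; congr 1; ring

lemma hasFDerivAt_gaussDensity (z : En n) :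
    HasFDerivAt (gaussDensity n) (-gaussDensity n z • innerSL ℝ z) z := by
  have := (((hasStrictFDerivAt_norm_sq z).hasFDerivAt.const_mul (-(1 / 2))).exp).const_mul
    ((2 * Real.pi) ^ (-(n : ℝ) / 2))
  refine this.congr_fderiv ?_
  ext v
  simp [gaussDensity]
  ring

/-- Gaussian integration by parts in a coordinate direction. -/
lemma integral_coord_mul_gaussMeasure {h : En n → ℝ} (hh : ContDiff ℝ 1 h) {C : ℝ}
    (hb : ∀ z, |h z| ≤ C) (i : Fin n) (hb' : ∀ z, |pd i h z| ≤ C) :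
    Integrable (fun z => z i * h z) (gaussMeasure n) ∧
      ∫ z, z i * h z ∂gaussMeasure n = ∫ z, pd i h z ∂gaussMeasure n := by
  have hpc : Continuous (pd i h) := (contDiff_pd (k := 0) hh (by norm_num) i).continuous
  have hc : Continuous fun z : En n => z i := (EuclideanSpace.proj i : En n →L[ℝ] ℝ).continuous
  have h1 : Integrable (fun z => z i * h z) (gaussMeasure n) := by
    refine (integrable_norm_gaussMeasure.mul_const C).mono'
      (hc.mul hh.continuous).aestronglyMeasurable (ae_of_all _ fun z => ?_)
    rw [norm_mul]
    exact mul_le_mul (PiLp.norm_apply_le z i) (hb z) (norm_nonneg _) (norm_nonneg _)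
  have h2 : Integrable (pd i h) (gaussMeasure n) :=
    (integrable_const C).mono' hpc.aestronglyMeasurable (ae_of_all _ hb')
  have h3 : Integrable h (gaussMeasure n) :=
    (integrable_const C).mono' hh.continuous.aestronglyMeasurable (ae_of_all _ hb)
  refine ⟨h1, ?_⟩
  have hg : ∀ z, fderiv ℝ (gaussDensity n) z (EuclideanSpace.single i 1)
      = -(gaussDensity n z * z i) := fun z => by
    rw [(hasFDerivAt_gaussDensity z).fderiv]
    simp [EuclideanSpace.inner_single_right]
  rw [integrable_gaussMeasure] at h1 h2 h3
  have := integral_mul_fderiv_eq_neg_fderiv_mul_of_integrable (μ := volume) (f := h)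
    (g := gaussDensity n) (v := EuclideanSpace.single i (1 : ℝ))
    (by simpa [pd, mul_comm] using h2)
    (by
      simp only [hg]
      exact h1.neg.congr (ae_of_all _ fun z => by simp; ring))
    (by simpa [mul_comm] using h3)
    (fun z _ => hh.differentiable (by norm_num) z)
    (fun z _ => (hasFDerivAt_gaussDensity z).differentiableAt)
  rw [integral_gaussMeasure, integral_gaussMeasure, ← neg_inj, ← integral_neg]
  simp only [hg] at this
  calc ∫ z, -(gaussDensity n z * (z i * h z)) = ∫ z, h z * -(gaussDensity n z * z i) := by
        congr 1; ext z; ring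
    _ = _ := this
    _ = _ := by simp only [pd, mul_comm]

lemma HasCompactSupport.pd {h : En n → ℝ} (hc : HasCompactSupport h) (i : Fin n) :
    HasCompactSupport (pd i h) :=
  hc.fderiv_apply ℝ _

lemma pd_comp_affine {h : En n → ℝ} (hh : Differentiable ℝ h) (i : Fin n) (a : En n) (r : ℝ)
    (z : En n) : pd i (fun z => h (a + r • z)) z = r * pd i h (a + r • z) := by
  have h2 : HasFDerivAt (fun z : En n => h (a + r • z)) _ z :=
    (hh (a + r • z)).hasFDerivAt.comp z (((hasFDerivAt_id z).const_smul r).const_add a)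
  rw [_root_.pd, h2.fderiv]
  simp [_root_.pd]

lemma integral_fderiv_self_gaussMeasure {g : En n → ℝ} (hg : ContDiff ℝ 2 g)
    (hc : HasCompactSupport g) (a : En n) (r : ℝ) :
    ∫ z, fderiv ℝ g (a + r • z) z ∂gaussMeasure n
      = r * ∫ z, lap g (a + r • z) ∂gaussMeasure n := by
  have hp : ∀ i, ContDiff ℝ 1 (pd i g) := fun i => contDiff_pd hg (by norm_num) i
  have hpp : ∀ i, Continuous (pd i (pd i g)) := fun i =>
    (contDiff_pd (k := 0) (hp i) (by norm_num) i).continuous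
  have hl : ContDiff ℝ 1 fun z : En n => a + r • z := by fun_prop
  have hb' : ∀ i, ∃ C, ∀ z, ‖pd i (pd i g) z‖ ≤ C := fun i =>
    ((hc.pd i).pd i).exists_bound_of_continuous (hpp i)
  have key : ∀ i, Integrable (fun z => z i * pd i g (a + r • z)) (gaussMeasure n) ∧
      ∫ z, z i * pd i g (a + r • z) ∂gaussMeasure n
        = r * ∫ z, pd i (pd i g) (a + r • z) ∂gaussMeasure n := by
    intro i
    obtain ⟨C, hC⟩ := (hc.pd i).exists_bound_of_continuous (hp i).continuous
    obtain ⟨C', hC'⟩ := hb' i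
    have e := fun z => pd_comp_affine ((hp i).differentiable (by norm_num)) i a r z
    have := integral_coord_mul_gaussMeasure ((hp i).comp hl) (C := max C (|r| * C'))
      (fun z => (hC _).trans (le_max_left _ _)) i (fun z => by
        simp only [Function.comp_def, e]
        rw [abs_mul]
        exact (mul_le_mul_of_nonneg_left (hC' _) (abs_nonneg r)).trans (le_max_right _ _))
    simpa only [Function.comp_def, e, integral_const_mul] using this
  simp only [← sum_mul_pd, lap]
  rw [integral_finsetSum _ fun i _ => (key i).1, integral_finsetSum, Finset.mul_sum]
  · exact Finset.sum_congr rfl fun i _ => (key i).2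
  · intro i _
    obtain ⟨C', hC'⟩ := hb' i
    exact (integrable_const C').mono' ((hpp i).comp hl.continuous).aestronglyMeasurable
      (ae_of_all _ fun z => hC' _)

lemma exists_bound_fderiv (hf : ContDiff ℝ 2 f) (hfc : HasCompactSupport f) :
    ∃ C, ∀ p, ‖fderiv ℝ f p‖ ≤ C :=
  (hfc.fderiv ℝ).exists_bound_of_continuous (hf.continuous_fderiv (by norm_num))

lemma hasDerivAt_potential_time (hn : 1 ≤ n) (hf : ContDiff ℝ 2 f) (hfc : HasCompactSupport f)
    (t : ℝ) (x : En n) :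
    Integrable (fun ω : ℝ × En n => Real.exp (-(tanh2 ω.1 / 2 * ‖x‖ ^ 2)) *
        fderiv ℝ f (t - ω.1, sech2 ω.1 • x + √(tanh2 ω.1) • ω.2) (1, 0))
        ((timeMeasure n).prod (gaussMeasure n)) ∧
      HasDerivAt (fun s => potential f s x)
        (∫ ω : ℝ × En n, Real.exp (-(tanh2 ω.1 / 2 * ‖x‖ ^ 2)) *
          fderiv ℝ f (t - ω.1, sech2 ω.1 • x + √(tanh2 ω.1) • ω.2) (1, 0)
          ∂(timeMeasure n).prod (gaussMeasure n)) t := by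
  have := isFiniteMeasure_timeMeasure hn
  have hT := continuous_tanh2
  have hS := continuous_sech2
  have hf0 := hf.continuous
  have hf1 := hf.continuous_fderiv (by norm_num)
  obtain ⟨M, hM⟩ := hfc.exists_bound_of_continuous hf0
  obtain ⟨C, hC⟩ := exists_bound_fderiv hf hfc
  have he : ∀ᵐ ω : ℝ × En n ∂(timeMeasure n).prod (gaussMeasure n),
      |Real.exp (-(tanh2 ω.1 / 2 * ‖x‖ ^ 2))| ≤ 1 := by
    filter_upwards [ae_fst_pos n] with ω hω
    rw [Real.abs_exp, Real.exp_le_one_iff]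
    have := tanh2_pos hω
    simp only [Left.neg_nonpos_iff]
    positivity
  have hm : ∀ s : ℝ, Continuous fun ω => oscIntegrand f (oscParam s ω) x := fun s => by
    simp only [oscIntegrand, oscParam]
    fun_prop
  refine hasDerivAt_integral_of_dominated_loc_of_deriv_le
    (bound := fun _ => C * ‖((1 : ℝ), (0 : En n))‖)
    (F := fun s ω => oscIntegrand f (oscParam s ω) x)
    (F' := fun s ω => Real.exp (-(tanh2 ω.1 / 2 * ‖x‖ ^ 2)) *
        fderiv ℝ f (s - ω.1, sech2 ω.1 • x + √(tanh2 ω.1) • ω.2) (1, 0)) univ_mem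
    (Eventually.of_forall fun s => (hm s).aestronglyMeasurable)
    ((integrable_const M).mono' (hm t).aestronglyMeasurable ?_) ?_ ?_ (integrable_const _)
    (ae_of_all _ fun ω s _ => ?_)
  · filter_upwards [he] with ω hω
    rw [oscIntegrand, norm_mul]
    exact (mul_le_of_le_one_left (norm_nonneg _) hω).trans (hM _)
  · exact Continuous.aestronglyMeasurable (by fun_prop)
  · filter_upwards [he] with ω hω s _
    rw [norm_mul]
    exact (mul_le_of_le_one_left (norm_nonneg _) hω).trans
      (ContinuousLinearMap.le_of_opNorm_le _ (hC _) _)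
  · have h1 := (hf.differentiable (by norm_num)
      (s - ω.1, sech2 ω.1 • x + √(tanh2 ω.1) • ω.2)).hasFDerivAt
    have h2 : HasDerivAt (fun s : ℝ => (s - ω.1, sech2 ω.1 • x + √(tanh2 ω.1) • ω.2))
        ((1 : ℝ), (0 : En n)) s := ((hasDerivAt_id s).sub_const ω.1).prodMk (hasDerivAt_const s _)
    exact (h1.comp_hasDerivAt s h2).const_mul (Real.exp (-(tanh2 ω.1 / 2 * ‖x‖ ^ 2)))

/-- The value of the rescaled Gaussian average along the backward characteristic. -/
def gaussAverage (f : ℝ × En n → ℝ) (t : ℝ) (x : En n) (τ : ℝ) : ℝ :=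
  ∫ z, f (t - τ, sech2 τ • x + √(tanh2 τ) • z) ∂gaussMeasure n

lemma hasDerivAt_sqrt_tanh2 {τ : ℝ} (hτ : 0 < τ) :
    HasDerivAt (fun τ => √(tanh2 τ)) (sech2 τ ^ 2 / √(tanh2 τ)) τ := by
  refine ((hasDerivAt_tanh2 τ).sqrt (tanh2_pos hτ).ne').congr_deriv ?_
  rw [mul_div_mul_left _ _ two_ne_zero]

lemma hasDerivAt_gaussAverage (hf : ContDiff ℝ 2 f) (hfc : HasCompactSupport f) (t : ℝ) (x : En n)
    {τ : ℝ} (hτ : 0 < τ) :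
    Integrable (fun z => fderiv ℝ f (t - τ, sech2 τ • x + √(tanh2 τ) • z)
      (-1, (-2 * sech2 τ * tanh2 τ) • x + (sech2 τ ^ 2 / √(tanh2 τ)) • z)) (gaussMeasure n) ∧
    HasDerivAt (gaussAverage f t x)
      (∫ z, fderiv ℝ f (t - τ, sech2 τ • x + √(tanh2 τ) • z)
      (-1, (-2 * sech2 τ * tanh2 τ) • x + (sech2 τ ^ 2 / √(tanh2 τ)) • z) ∂gaussMeasure n) τ := by
  have hT := continuous_tanh2
  have hS := continuous_sech2
  have hf0 := hf.continuous
  have hf1 := hf.continuous_fderiv (by norm_num)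
  obtain ⟨M, hM⟩ := hfc.exists_bound_of_continuous hf0
  obtain ⟨C, hC⟩ := exists_bound_fderiv hf hfc
  have hC0 : 0 ≤ C := (norm_nonneg _).trans (hC 0)
  have hr : 0 < √(tanh2 τ) := Real.sqrt_pos.2 (tanh2_pos hτ)
  have hA : ∀ᶠ σ in 𝓝 τ, ‖(-2 * sech2 σ * tanh2 σ) • x‖ ≤ ‖(-2 * sech2 τ * tanh2 τ) • x‖ + 1 :=
    Tendsto.eventually_le_const (lt_add_one _)
      (by fun_prop : Continuous fun σ => ‖(-2 * sech2 σ * tanh2 σ) • x‖).continuousAt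
  have hB : ∀ᶠ σ in 𝓝 τ, |sech2 σ ^ 2 / √(tanh2 σ)| ≤ |sech2 τ ^ 2 / √(tanh2 τ)| + 1 := by
    have : ContinuousAt (fun σ => |sech2 σ ^ 2 / √(tanh2 σ)|) τ :=
      ((by fun_prop : ContinuousAt (fun σ => sech2 σ ^ 2) τ).div (by fun_prop) hr.ne').abs
    exact this.eventually_le_const (lt_add_one _)
  set A := ‖(-2 * sech2 τ * tanh2 τ) • x‖ + 1
  set B := |sech2 τ ^ 2 / √(tanh2 τ)| + 1
  have hm : ∀ σ : ℝ, Continuous fun z : En n => f (t - σ, sech2 σ • x + √(tanh2 σ) • z) :=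
    fun σ => by fun_prop
  have hgi : Integrable (fun z : En n => C * (1 + (A + B * ‖z‖))) (gaussMeasure n) :=
    ((integrable_const _).add ((integrable_const _).add
      (integrable_norm_gaussMeasure.const_mul B))).const_mul C
  refine hasDerivAt_integral_of_dominated_loc_of_deriv_le
    (F := fun σ z => f (t - σ, sech2 σ • x + √(tanh2 σ) • z))
    (F' := fun σ z => fderiv ℝ f (t - σ, sech2 σ • x + √(tanh2 σ) • z)
      (-1, (-2 * sech2 σ * tanh2 σ) • x + (sech2 σ ^ 2 / √(tanh2 σ)) • z))
    ((hA.and hB).and (lt_mem_nhds hτ))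
    (Eventually.of_forall fun s => (hm s).aestronglyMeasurable)
    ((integrable_const M).mono' (hm τ).aestronglyMeasurable (ae_of_all _ fun z => hM _)) ?_
    (ae_of_all _ fun z σ hσ => ?_) hgi (ae_of_all _ fun z σ hσ => ?_)
  · exact Continuous.aestronglyMeasurable (by fun_prop)
  · obtain ⟨⟨hA, hB⟩, hσ⟩ := hσ
    refine (ContinuousLinearMap.le_of_opNorm_le _ (hC _) _).trans
      (mul_le_mul_of_nonneg_left ?_ hC0)
    have h1 : ‖(-2 * sech2 σ * tanh2 σ) • x + (sech2 σ ^ 2 / √(tanh2 σ)) • z‖ ≤ A + B * ‖z‖ := by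
      refine (norm_add_le _ _).trans (add_le_add hA ?_)
      rw [norm_smul, Real.norm_eq_abs]
      exact mul_le_mul_of_nonneg_right hB (norm_nonneg _)
    have h2 := (norm_nonneg _).trans h1
    rw [Prod.norm_def]
    refine max_le ?_ ?_
    · simp only [norm_neg, norm_one]
      linarith
    · dsimp only
      linarith
  · have h1 := (hf.differentiable (by norm_num)
      (t - σ, sech2 σ • x + √(tanh2 σ) • z)).hasFDerivAt
    have h2 : HasDerivAt (fun σ : ℝ => (t - σ, sech2 σ • x + √(tanh2 σ) • z))
        ((-1 : ℝ), (-2 * sech2 σ * tanh2 σ) • x + (sech2 σ ^ 2 / √(tanh2 σ)) • z) σ :=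
      ((hasDerivAt_id σ).const_sub t).prodMk
        (((hasDerivAt_sech2 σ).smul_const x).add ((hasDerivAt_sqrt_tanh2 hσ.2).smul_const z))
    exact h1.comp_hasDerivAt σ h2

lemma contDiff_slice {k : WithTop ℕ∞} (hf : ContDiff ℝ k f) (s : ℝ) :
    ContDiff ℝ k fun y => f (s, y) :=
  hf.comp (by fun_prop : ContDiff ℝ k fun y : En n => (s, y))

lemma hasCompactSupport_slice (hfc : HasCompactSupport f) (s : ℝ) :
    HasCompactSupport fun y => f (s, y) :=
  hfc.comp_isClosedEmbedding <|
    Function.LeftInverse.isClosedEmbedding (f := Prod.snd) (fun _ => rfl) continuous_snd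
      (by fun_prop)

lemma fderiv_slice (hf : Differentiable ℝ f) (s : ℝ) (y w : En n) :
    fderiv ℝ (fun y => f (s, y)) y w = fderiv ℝ f (s, y) (0, w) := by
  have h : HasFDerivAt (fun y : En n => f (s, y)) _ y :=
    (hf (s, y)).hasFDerivAt.comp y (hasFDerivAt_prodMk_right s y)
  rw [h.fderiv]
  simp

/-- The integrand of `∂_τ` of the Mehler semigroup applied to `f (t - τ, ·)`. -/
def flowIntegrand (f : ℝ × En n → ℝ) (t : ℝ) (x : En n) (ω : ℝ × En n) : ℝ :=
  lap (oscIntegrand f (oscParam t ω)) x - ‖x‖ ^ 2 * oscIntegrand f (oscParam t ω) x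
    - Real.exp (-(tanh2 ω.1 / 2 * ‖x‖ ^ 2)) *
      fderiv ℝ f (t - ω.1, sech2 ω.1 • x + √(tanh2 ω.1) • ω.2) (1, 0)

lemma integrable_lap_gaussMeasure {g : En n → ℝ} (hg : ContDiff ℝ 2 g) (hc : HasCompactSupport g)
    (a : En n) (r : ℝ) : Integrable (fun z => lap g (a + r • z)) (gaussMeasure n) := by
  refine integrable_finsetSum _ fun i _ => ?_
  have hp : Continuous (pd i (pd i g)) :=
    (contDiff_pd (k := 0) (contDiff_pd (k := 1) hg (by norm_num) i) (by norm_num) i).continuous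
  obtain ⟨C, hC⟩ := ((hc.pd i).pd i).exists_bound_of_continuous hp
  exact (integrable_const C).mono' (Continuous.aestronglyMeasurable (by fun_prop))
    (ae_of_all _ fun z => hC _)

lemma integral_flowIntegrand (hf : ContDiff ℝ 2 f) (hfc : HasCompactSupport f) (t : ℝ) (x : En n)
    {τ : ℝ} (hτ : 0 < τ) :
    ∫ z, flowIntegrand f t x (τ, z) ∂gaussMeasure n
      = Real.exp (-(tanh2 τ / 2 * ‖x‖ ^ 2)) *
        ((-n * tanh2 τ - sech2 τ ^ 2 * ‖x‖ ^ 2) * gaussAverage f t x τ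
        + ∫ z, fderiv ℝ f (t - τ, sech2 τ • x + √(tanh2 τ) • z)
      (-1, (-2 * sech2 τ * tanh2 τ) • x + (sech2 τ ^ 2 / √(tanh2 τ)) • z) ∂gaussMeasure n) := by
  have hr : √(tanh2 τ) ≠ 0 := (Real.sqrt_pos.2 (tanh2_pos hτ)).ne'
  have hfd := hf.differentiable (by norm_num)
  have hf0 := hf.continuous
  have hf1 := hf.continuous_fderiv (by norm_num)
  have hg := contDiff_slice hf (t - τ)
  have hgc := hasCompactSupport_slice hfc (t - τ)
  obtain ⟨M, hM⟩ := hfc.exists_bound_of_continuous hf0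
  obtain ⟨C, hC⟩ := exists_bound_fderiv hf hfc
  have i1 : Integrable (fun z => f (t - τ, sech2 τ • x + √(tanh2 τ) • z)) (gaussMeasure n) :=
    (integrable_const M).mono' (Continuous.aestronglyMeasurable (by fun_prop))
      (ae_of_all _ fun z => hM _)
  have i2 : ∀ w, Integrable (fun z => fderiv ℝ f (t - τ, sech2 τ • x + √(tanh2 τ) • z) w)
      (gaussMeasure n) := fun w =>
    (integrable_const (C * ‖w‖)).mono' (Continuous.aestronglyMeasurable (by fun_prop))
      (ae_of_all _ fun z => ContinuousLinearMap.le_of_opNorm_le _ (hC _) _)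
  have i3 := integrable_lap_gaussMeasure hg hgc (sech2 τ • x) (√(tanh2 τ))
  have i4 := (hasDerivAt_gaussAverage hf hfc t x hτ).1
  have ibp := integral_fderiv_self_gaussMeasure hg hgc (sech2 τ • x) (√(tanh2 τ))
  simp only [fderiv_slice hfd] at ibp
  have e : ∀ z, fderiv ℝ f (t - τ, sech2 τ • x + √(tanh2 τ) • z)
      (-1, (-2 * sech2 τ * tanh2 τ) • x + (sech2 τ ^ 2 / √(tanh2 τ)) • z)
      = -fderiv ℝ f (t - τ, sech2 τ • x + √(tanh2 τ) • z) (1, 0)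
        + (-2 * sech2 τ * tanh2 τ) * fderiv ℝ f (t - τ, sech2 τ • x + √(tanh2 τ) • z) (0, x)
        + (sech2 τ ^ 2 / √(tanh2 τ))
          * fderiv ℝ f (t - τ, sech2 τ • x + √(tanh2 τ) • z) (0, z) := by
    intro z
    have hv : ((-1 : ℝ), (-2 * sech2 τ * tanh2 τ) • x + (sech2 τ ^ 2 / √(tanh2 τ)) • z)
        = -(1, 0) + (-2 * sech2 τ * tanh2 τ) • ((0 : ℝ), x)
          + (sech2 τ ^ 2 / √(tanh2 τ)) • ((0 : ℝ), z) := by simp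
    rw [hv, map_add, map_add, map_neg, map_smul, map_smul, smul_eq_mul, smul_eq_mul]
  have hs := (sech2_pos τ).ne'
  have i5 : Integrable (fun z => fderiv ℝ f (t - τ, sech2 τ • x + √(tanh2 τ) • z) (0, z))
      (gaussMeasure n) := by
    have := ((i4.add (i2 (1, 0))).sub ((i2 (0, x)).const_mul (-2 * sech2 τ * tanh2 τ))).const_mul
      (sech2 τ ^ 2 / √(tanh2 τ))⁻¹
    refine this.congr (ae_of_all _ fun z => ?_)
    simp only [Pi.add_apply, Pi.sub_apply, e]
    field_simp
    ring
  have hF : ∀ z, flowIntegrand f t x (τ, z) = Real.exp (-(tanh2 τ / 2 * ‖x‖ ^ 2)) *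
      ((-n * tanh2 τ - sech2 τ ^ 2 * ‖x‖ ^ 2) * f (t - τ, sech2 τ • x + √(tanh2 τ) • z)
        + (-2 * sech2 τ * tanh2 τ) * fderiv ℝ f (t - τ, sech2 τ • x + √(tanh2 τ) • z) (0, x)
        + sech2 τ ^ 2 * lap (fun y => f (t - τ, y)) (sech2 τ • x + √(tanh2 τ) • z)
        - fderiv ℝ f (t - τ, sech2 τ • x + √(tanh2 τ) • z) (1, 0)) := by
    intro z
    have := lap_exp_mul_comp hg (tanh2 τ) (sech2 τ) (√(tanh2 τ) • z) x
    rw [fderiv_slice hfd, tanh2_sq] at this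
    unfold flowIntegrand oscIntegrand oscParam
    dsimp only
    rw [this]
    ring
  simp only [hF, e]
  rw [integral_const_mul, integral_sub, integral_add, integral_add, integral_add, integral_add,
    integral_neg, integral_const_mul, integral_const_mul, integral_const_mul, integral_const_mul,
    ibp, gaussAverage]
  · field_simp
    ring
  · exact (i2 _).neg
  · exact (i2 _).const_mul _
  · exact (i2 _).neg.add ((i2 _).const_mul _)
  · exact i5.const_mul _
  · exact i1.const_mul _
  · exact (i2 _).const_mul _
  · exact (i1.const_mul _).add ((i2 _).const_mul _)
  · exact i3.const_mul _
  · exact ((i1.const_mul _).add ((i2 _).const_mul _)).add (i3.const_mul _)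
  · exact i2 _

lemma continuous_gaussAverage (hf : Continuous f) (hfc : HasCompactSupport f) (t : ℝ) (x : En n) :
    Continuous (gaussAverage f t x) := by
  have hT := continuous_tanh2
  have hS := continuous_sech2
  obtain ⟨M, hM⟩ := hfc.exists_bound_of_continuous hf
  exact continuous_of_dominated (bound := fun _ => M)
    (fun τ => Continuous.aestronglyMeasurable (by fun_prop))
    (fun τ => ae_of_all _ fun z => hM _) (integrable_const M) (ae_of_all _ fun z => by fun_prop)

lemma integral_flowIntegrand_prod (hn : 1 ≤ n) (hf : ContDiff ℝ 2 f) (hfc : HasCompactSupport f)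
    (t : ℝ) (x : En n)
    (hi : Integrable (flowIntegrand f t x) ((timeMeasure n).prod (gaussMeasure n))) :
    ∫ ω, flowIntegrand f t x ω ∂(timeMeasure n).prod (gaussMeasure n) = -f (t, x) := by
  have := isFiniteMeasure_timeMeasure hn
  have hmass : ∫ _z, (1 : ℝ) ∂gaussMeasure n = 1 := by
    rw [integral_gaussMeasure]
    simpa using integral_gaussDensity n
  obtain ⟨M, hM⟩ := hfc.exists_bound_of_continuous hf.continuous
  have hT := continuous_tanh2
  have hG := continuous_gaussAverage hf.continuous hfc t x
  set q : ℝ → ℝ := fun τ =>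
    timeDensity n τ * (Real.exp (-(tanh2 τ / 2 * ‖x‖ ^ 2)) * gaussAverage f t x τ) with hq
  have hqc : Continuous q := by
    have := continuous_timeDensity n
    fun_prop
  have hq0 : q 0 = f (t, x) := by
    have : f (t, x) = ∫ _z, f (t, x) * 1 ∂gaussMeasure n := by
      rw [integral_const_mul, hmass, mul_one]
    simp only [hq, gaussAverage, timeDensity, tanh2, sech2]
    simp only [mul_one] at this
    simp [← this]
  have hG_le : ∀ τ, |gaussAverage f t x τ| ≤ M := fun τ => by
    refine (norm_integral_le_of_norm_le (integrable_const M) (ae_of_all _ fun z => hM _)).trans ?_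
    have : ∫ _z, M * 1 ∂gaussMeasure n = M := by rw [integral_const_mul, hmass, mul_one]
    simpa using this.le
  have hlim : Tendsto q atTop (𝓝 0) := by
    have h0 : Tendsto (fun τ => timeDensity n τ * M) atTop (𝓝 0) := by
      simpa using (tendsto_timeDensity hn).mul_const M
    refine squeeze_zero_norm' ?_ h0
    filter_upwards [eventually_gt_atTop 0] with τ hτ
    have hpos := tanh2_pos hτ
    rw [hq, norm_mul, norm_mul, Real.norm_of_nonneg (timeDensity_pos n τ).le,
      Real.norm_of_nonneg (Real.exp_pos _).le]
    refine mul_le_mul_of_nonneg_left ?_ (timeDensity_pos n τ).le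
    refine (mul_le_of_le_one_left (norm_nonneg _) (Real.exp_le_one_iff.2 ?_)).trans (hG_le τ)
    simp only [Left.neg_nonpos_iff]
    positivity
  have hd : ∀ τ ∈ Ioi (0 : ℝ), HasDerivAt q
      (timeDensity n τ * ∫ z, flowIntegrand f t x (τ, z) ∂gaussMeasure n) τ := by
    intro τ hτ
    have h1 := (hasDerivAt_gaussAverage hf hfc t x hτ).2
    have h2 := ((((hasDerivAt_tanh2 τ).div_const 2).mul_const (‖x‖ ^ 2)).neg).exp
    refine ((hasDerivAt_timeDensity n τ).mul (h2.mul h1)).congr_deriv ?_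
    rw [integral_flowIntegrand hf hfc t x hτ]
    simp only [Pi.mul_apply, Pi.neg_apply]
    ring
  have hint := integrable_timeMeasure.1 hi.integral_prod_left
  rw [integral_prod _ hi, integral_timeMeasure,
    integral_Ioi_of_hasDerivAt_of_tendsto hqc.continuousWithinAt hd hint hlim, hq0, zero_sub]

end Integrand

/-- for `f` bounded, measurable and compactly supported on `ℝ^{n+1}`, the
integral `u(t,x) = ∫₀^∞ ∫_{ℝⁿ} 𝒲_τ(x,y) f(t-τ,y) dy dτ` converges absolutely (the kernel
vanishes for `τ ≤ 0`); if moreover `f` is `C²`, then `u` is a classical solution of the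
harmonic oscillator evolution equation `∂_t u = Δu − |x|²u + f` on `ℝ^{n+1}`. -/
theorem hermite_global_classical_solvability (n : ℕ) (hn : 1 ≤ n)
    (f : ℝ × En n → ℝ) (hfb : ∃ M, ∀ z, |f z| ≤ M) (hfm : Measurable f)
    (hfc : HasCompactSupport f) :
    (∀ (t : ℝ) (x : En n),
      Integrable (fun p : ℝ × En n => Mehler n p.1 x p.2 * f (t - p.1, p.2))) ∧
    (ContDiff ℝ 2 f →
      (∀ t : ℝ, ContDiff ℝ 2
        (fun x : En n => ∫ p : ℝ × En n, Mehler n p.1 x p.2 * f (t - p.1, p.2))) ∧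
      ∀ (t : ℝ) (x : En n),
        HasDerivAt (fun s : ℝ => ∫ p : ℝ × En n, Mehler n p.1 x p.2 * f (s - p.1, p.2))
          (lap (fun x' : En n => ∫ p : ℝ × En n, Mehler n p.1 x' p.2 * f (t - p.1, p.2)) x
            - ‖x‖ ^ 2 * (∫ p : ℝ × En n, Mehler n p.1 x p.2 * f (t - p.1, p.2))
            + f (t, x)) t) := by
  obtain ⟨M, hM⟩ := hfb
  refine ⟨fun t x => integrable_Mehler_mul hn hM hfm t x, fun hf => ?_⟩
  have hu : ∀ t x, ∫ p : ℝ × En n, Mehler n p.1 x p.2 * f (t - p.1, p.2) = potential f t x :=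
    fun t x => integral_Mehler_prod hn hM hf.continuous t x
  simp only [hu]
  refine ⟨contDiff_potential hn hf hfc, fun t x => ?_⟩
  have := isFiniteMeasure_timeMeasure hn
  obtain ⟨hti, htd⟩ := hasDerivAt_potential_time hn hf hfc t x
  obtain ⟨hli, hl⟩ := lap_potential hn hf hfc t x
  have hoi : Integrable (fun ω => oscIntegrand f (oscParam t ω) x)
      ((timeMeasure n).prod (gaussMeasure n)) := by
    obtain ⟨C, hC⟩ := exists_ae_bound hfc (contDiff_oscIntegrand hf).continuous
      (fun p x hp => (oscIntegrand_eventuallyEq_zero hp).eq_of_nhds) t ‖x‖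
    exact (integrable_const C).mono' ((contDiff_oscIntegrand hf).continuous.comp
      ((continuous_oscParam t).prodMk continuous_const)).aestronglyMeasurable
      (hC.mono fun ω h => h x le_rfl)
  have hsi : Integrable (fun ω => lap (oscIntegrand f (oscParam t ω)) x
      - ‖x‖ ^ 2 * oscIntegrand f (oscParam t ω) x) ((timeMeasure n).prod (gaussMeasure n)) :=
    hli.sub (hoi.const_mul _)
  have hflow := integral_flowIntegrand_prod hn hf hfc t x (hsi.sub hti)
  simp only [flowIntegrand] at hflow
  rw [integral_sub hsi hti, integral_sub hli (hoi.const_mul _), integral_const_mul, ← hl,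
    ← potential] at hflow
  refine htd.congr_deriv ?_
  change _ = lap (potential f t) x - _ + _
  linarith
end
end

section
/- Let n ≥ 1. There exist constants C, c > 0 depending only on n such that for all τ > 0 and all x, y ∈ ℝⁿ, 𝒲_τ(x,y) ≤ C τ^{-n/2} e^{−|x−y|²/(cτ)}. -/
open MeasureTheory Filter Set Metric
open scoped ENNReal NNReal Topology

noncomputable section

/-- On the positive half-line, `coth τ` is at least `1 / (2 τ)`. -/
lemma inv_two_mul_le_coth {τ : ℝ} (hτ : 0 < τ) : 1 / (2 * τ) ≤ coth τ := by
  rw [coth, div_le_div_iff₀ (by positivity) (Real.sinh_pos_iff.2 hτ), Real.sinh_eq, Real.cosh_eq]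
  have hneg : Real.exp (-τ) = Real.exp τ * Real.exp (-2 * τ) := by
    rw [← Real.exp_add]; ring_nf
  have hle : 1 - Real.exp (-2 * τ) ≤ 2 * τ := by
    linarith [Real.add_one_le_exp (-2 * τ)]
  have hmul := mul_le_mul_of_nonneg_left hle (Real.exp_pos τ).le
  have hpos := mul_pos hτ (Real.exp_pos (-τ))
  linarith

/-- Gaussian upper bound for the Mehler kernel:
`𝒲_τ(x,y) ≤ C τ^{-n/2} e^{-|x-y|²/(cτ)}` for all `τ > 0` and `x,y ∈ ℝⁿ`,
with `C, c > 0` depending only on `n`. -/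
theorem mehler_gaussian_upper_bound (n : ℕ) (hn : 1 ≤ n) :
    ∃ C c : ℝ, 0 < C ∧ 0 < c ∧ ∀ (τ : ℝ), 0 < τ → ∀ x y : En n,
      Mehler n τ x y ≤ C * τ ^ (-(n : ℝ) / 2) * Real.exp (-‖x - y‖ ^ 2 / (c * τ)) := by
  refine ⟨1, 8, one_pos, by norm_num, fun τ hτ x y => ?_⟩
  rw [Mehler, if_pos hτ, one_mul]
  have hbase : τ ≤ 2 * Real.pi * Real.sinh (2 * τ) := by
    have hsinh : 2 * τ ≤ Real.sinh (2 * τ) := Real.self_le_sinh_iff.2 (by positivity)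
    nlinarith [Real.pi_gt_three]
  have htanh : 0 ≤ Real.tanh τ := by
    rw [Real.tanh_eq_sinh_div_cosh]
    exact div_nonneg (Real.sinh_nonneg_iff.2 hτ.le) (Real.cosh_pos τ).le
  have hcoth := mul_le_mul_of_nonneg_left (inv_two_mul_le_coth hτ) (sq_nonneg ‖x - y‖)
  have hplus := mul_nonneg (sq_nonneg ‖x + y‖) htanh
  have hexp : -‖x - y‖ ^ 2 / (8 * τ) = -(1 / 4) * (‖x - y‖ ^ 2 * (1 / (2 * τ))) := by
    field_simp
    ring
  refine mul_le_mul (Real.rpow_le_rpow_of_nonpos hτ hbase ?_) (Real.exp_le_exp.2 ?_)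
    (Real.exp_pos _).le (by positivity)
  · have : (0 : ℝ) ≤ n := n.cast_nonneg
    linarith
  · linarith
end
end

section
/- Let n ≥ 1 and fix i, j ∈ {1,…,n}. There exists a constant C depending only on n such that for all τ > 0 and all x, y ∈ ℝⁿ: |∂_{y_i y_j} 𝒲_τ(x,y)| ≤ C (|x−y| + τ^{1/2})^{−(n+2)}, |∇_y ∂_{y_i y_j} 𝒲_τ(x,y)| ≤ C (|x−y| + τ^{1/2})^{−(n+3)}, and |∂_τ ∂_{y_i y_j} 𝒲_τ(x,y)| ≤ C (|x−y| + τ^{1/2})^{−(n+4)}. -/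
open MeasureTheory Filter Set Metric
open scoped ENNReal NNReal Topology

noncomputable section

section MehlerBounds

variable {n : ℕ}

/-- The exponent of the Mehler kernel, so that `𝒲_τ(x,y) = (2π sinh 2τ)^{-n/2} exp(-phase)`. -/
def phase (τ : ℝ) (x y : En n) : ℝ :=
  1 / 4 * (‖x - y‖ ^ 2 * coth τ + ‖x + y‖ ^ 2 * Real.tanh τ)

/-- The gradient of `phase τ x` at `y`. -/
def phaseGrad (τ : ℝ) (x y : En n) : En n :=
  (1 / 2 : ℝ) • (Real.tanh τ • (x + y) - coth τ • (x - y))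

/-- The scalar `c` such that the Hessian of `phase τ x` is `c` times the identity. -/
def phaseHess (τ : ℝ) : ℝ := (coth τ + Real.tanh τ) / 2

/-- The prefactor `(2π sinh 2τ)^{-n/2}` of the Mehler kernel. -/
def prefactor (n : ℕ) (τ : ℝ) : ℝ :=
  (2 * Real.pi * Real.sinh (2 * τ)) ^ (-(n : ℝ) / 2)

/-- The second-order factor in `∂_{y_iy_j} 𝒲_τ = hessFactor * 𝒲_τ`. -/
def hessFactor (i j : Fin n) (τ : ℝ) (x y : En n) : ℝ :=
  phaseGrad τ x y i * phaseGrad τ x y j - phaseHess τ * (if j = i then 1 else 0)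

lemma mehler_eq {τ : ℝ} (hτ : 0 < τ) (x y : En n) :
    Mehler n τ x y = prefactor n τ * Real.exp (-phase τ x y) := by
  simp only [Mehler, if_pos hτ, prefactor, phase]
  congr 2
  ring

lemma hasFDerivAt_phase (τ : ℝ) (x y : En n) :
    HasFDerivAt (phase τ x) (innerSL ℝ (phaseGrad τ x y)) y := by
  have h1 := (((hasFDerivAt_id (𝕜 := ℝ) y).const_sub x).norm_sq).mul_const (coth τ)
  have h2 := (((hasFDerivAt_id (𝕜 := ℝ) y).const_add x).norm_sq).mul_const (Real.tanh τ)
  refine ((h1.add h2).const_mul (1 / 4)).congr_fderiv ?_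
  ext z
  simp [phaseGrad]
  ring

lemma hasFDerivAt_phaseGrad_apply (i : Fin n) (τ : ℝ) (x y : En n) :
    HasFDerivAt (fun y => phaseGrad τ x y i)
      (phaseHess τ • (EuclideanSpace.proj i : En n →L[ℝ] ℝ)) y := by
  have h : (fun y => phaseGrad τ x y i) = fun y : En n =>
      1 / 2 * ((Real.tanh τ - coth τ) * x i) +
        phaseHess τ * (EuclideanSpace.proj i : En n →L[ℝ] ℝ) y := by
    funext y
    simp [phaseGrad, phaseHess]
    ring
  rw [h]
  exact ((ContinuousLinearMap.hasFDerivAt _).const_mul _).const_add _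

lemma hasFDerivAt_mehler {τ : ℝ} (hτ : 0 < τ) (x y : En n) :
    HasFDerivAt (Mehler n τ x) (-(Mehler n τ x y) • innerSL ℝ (phaseGrad τ x y)) y := by
  rw [mehler_eq hτ, funext (mehler_eq hτ x)]
  refine ((hasFDerivAt_phase τ x y).neg.exp.const_mul _).congr_fderiv ?_
  ext z
  simp
  ring

lemma pd_mehler {τ : ℝ} (hτ : 0 < τ) (j : Fin n) (x y : En n) :
    pd j (Mehler n τ x) y = -(Mehler n τ x y * phaseGrad τ x y j) := by
  rw [pd, (hasFDerivAt_mehler hτ x y).fderiv]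
  simp [EuclideanSpace.inner_single_right]

lemma mij_eq {τ : ℝ} (hτ : 0 < τ) (i j : Fin n) (x y : En n) :
    Mij n i j τ x y = hessFactor i j τ x y * Mehler n τ x y := by
  have h := ((hasFDerivAt_mehler hτ x y).mul (hasFDerivAt_phaseGrad_apply j τ x y)).neg
  have hf : pd j (Mehler n τ x) = -(Mehler n τ x * fun y => phaseGrad τ x y j) :=
    funext (pd_mehler hτ j x)
  rw [Mij, hf, pd, h.fderiv]
  simp [EuclideanSpace.inner_single_right, hessFactor]
  split_ifs <;> ring

lemma hasFDerivAt_mij {τ : ℝ} (hτ : 0 < τ) (i j : Fin n) (x y : En n) :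
    HasFDerivAt (Mij n i j τ x)
      (Mehler n τ x y • ((phaseHess τ * phaseGrad τ x y i) • (EuclideanSpace.proj j : En n →L[ℝ] ℝ)
        + (phaseHess τ * phaseGrad τ x y j) • (EuclideanSpace.proj i : En n →L[ℝ] ℝ)
        - hessFactor i j τ x y • innerSL ℝ (phaseGrad τ x y))) y := by
  have h := ((((hasFDerivAt_phaseGrad_apply i τ x y).mul
    (hasFDerivAt_phaseGrad_apply j τ x y)).sub_const
      (phaseHess τ * (if j = i then 1 else 0))).mul (hasFDerivAt_mehler hτ x y))
  rw [funext (mij_eq hτ i j x)]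
  refine HasFDerivAt.congr_fderiv h ?_
  ext z
  simp [hessFactor]
  ring

lemma hasDerivAt_coth {τ : ℝ} (hτ : 0 < τ) : HasDerivAt coth (1 - coth τ ^ 2) τ := by
  have hs := (Real.sinh_pos_iff.2 hτ).ne'
  refine ((Real.hasDerivAt_cosh τ).div (Real.hasDerivAt_sinh τ) hs).congr_deriv ?_
  rw [coth]
  field_simp

lemma hasDerivAt_tanh (τ : ℝ) : HasDerivAt Real.tanh (1 - Real.tanh τ ^ 2) τ := by
  have hs := (Real.cosh_pos τ).ne'
  rw [funext Real.tanh_eq_sinh_div_cosh]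
  refine ((Real.hasDerivAt_sinh τ).div (Real.hasDerivAt_cosh τ) hs).congr_deriv ?_
  field_simp

lemma coth_mul_tanh {τ : ℝ} (hτ : 0 < τ) : coth τ * Real.tanh τ = 1 := by
  have hs := (Real.sinh_pos_iff.2 hτ).ne'
  have hc := (Real.cosh_pos τ).ne'
  rw [coth, Real.tanh_eq_sinh_div_cosh]
  field_simp

lemma tanh_pos_of_pos {τ : ℝ} (hτ : 0 < τ) : 0 < Real.tanh τ := by
  rw [Real.tanh_eq_sinh_div_cosh]
  exact div_pos (Real.sinh_pos_iff.2 hτ) (Real.cosh_pos τ)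

lemma one_lt_coth {τ : ℝ} (hτ : 0 < τ) : 1 < coth τ := by
  rw [coth, one_lt_div (Real.sinh_pos_iff.2 hτ)]
  exact Real.sinh_lt_cosh τ

lemma hasDerivAt_prefactor (n : ℕ) {τ : ℝ} (hτ : 0 < τ) :
    HasDerivAt (prefactor n) (-(n * phaseHess τ) * prefactor n τ) τ := by
  have hs : 0 < Real.sinh τ := Real.sinh_pos_iff.2 hτ
  have hc := Real.cosh_pos τ
  have hs2 : 0 < Real.sinh (2 * τ) := Real.sinh_pos_iff.2 (by positivity)
  have hpos : 0 < 2 * Real.pi * Real.sinh (2 * τ) := by positivity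
  have h1 : HasDerivAt (fun τ : ℝ => 2 * Real.pi * Real.sinh (2 * τ))
      (2 * Real.pi * (Real.cosh (2 * τ) * (2 * 1))) τ :=
    (((hasDerivAt_id τ).const_mul 2).sinh).const_mul _
  refine (h1.rpow_const (p := -(n : ℝ) / 2) (Or.inl hpos.ne')).congr_deriv ?_
  rw [Real.rpow_sub_one hpos.ne', prefactor, phaseHess, coth, Real.tanh_eq_sinh_div_cosh]
  generalize (2 * Real.pi * Real.sinh (2 * τ)) ^ (-(n : ℝ) / 2) = w
  rw [Real.sinh_two_mul, Real.cosh_two_mul]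
  field_simp

/-- The `τ`-derivative of `phase`. -/
def phaseDot (τ : ℝ) (x y : En n) : ℝ :=
  1 / 4 * (‖x - y‖ ^ 2 * (1 - coth τ ^ 2) + ‖x + y‖ ^ 2 * (1 - Real.tanh τ ^ 2))

/-- The `τ`-derivative of `phaseGrad`. -/
def phaseGradDot (τ : ℝ) (x y : En n) : En n :=
  (1 / 2 : ℝ) • ((1 - Real.tanh τ ^ 2) • (x + y) - (1 - coth τ ^ 2) • (x - y))

lemma hasDerivAt_phase {τ : ℝ} (hτ : 0 < τ) (x y : En n) :
    HasDerivAt (fun σ => phase σ x y) (phaseDot τ x y) τ :=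
  (((hasDerivAt_coth hτ).const_mul _).add ((hasDerivAt_tanh τ).const_mul _)).const_mul _

lemma hasDerivAt_phaseGrad_apply {τ : ℝ} (hτ : 0 < τ) (i : Fin n) (x y : En n) :
    HasDerivAt (fun σ => phaseGrad σ x y i) (phaseGradDot τ x y i) τ := by
  simp only [phaseGrad, phaseGradDot, PiLp.smul_apply, PiLp.sub_apply, smul_eq_mul]
  exact (((hasDerivAt_tanh τ).mul_const _).sub ((hasDerivAt_coth hτ).mul_const _)).const_mul _

lemma hasDerivAt_mehler {τ : ℝ} (hτ : 0 < τ) (x y : En n) :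
    HasDerivAt (fun σ => Mehler n σ x y)
      (-(n * phaseHess τ + phaseDot τ x y) * Mehler n τ x y) τ := by
  have h := (hasDerivAt_prefactor n hτ).mul (hasDerivAt_phase hτ x y).neg.exp
  refine (h.congr_of_eventuallyEq ?_).congr_deriv ?_
  · filter_upwards [lt_mem_nhds hτ] with σ hσ using mehler_eq hσ x y
  · rw [mehler_eq hτ]
    simp only [Pi.neg_apply]
    ring

lemma hasDerivAt_mij {τ : ℝ} (hτ : 0 < τ) (i j : Fin n) (x y : En n) :
    HasDerivAt (fun σ => Mij n i j σ x y)
      ((phaseGradDot τ x y i * phaseGrad τ x y j + phaseGrad τ x y i * phaseGradDot τ x y j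
        - ((1 - coth τ ^ 2) + (1 - Real.tanh τ ^ 2)) / 2 * (if j = i then 1 else 0)
        - hessFactor i j τ x y * (n * phaseHess τ + phaseDot τ x y)) * Mehler n τ x y) τ := by
  have hH : HasDerivAt phaseHess (((1 - coth τ ^ 2) + (1 - Real.tanh τ ^ 2)) / 2) τ :=
    ((hasDerivAt_coth hτ).add (hasDerivAt_tanh τ)).div_const 2
  have h := (((hasDerivAt_phaseGrad_apply hτ i x y).mul
    (hasDerivAt_phaseGrad_apply hτ j x y)).sub
      (hH.mul_const (if j = i then 1 else 0))).mul (hasDerivAt_mehler hτ x y)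
  refine (h.congr_of_eventuallyEq ?_).congr_deriv ?_
  · filter_upwards [lt_mem_nhds hτ] with σ hσ using mij_eq hσ i j x y
  · simp only [Pi.mul_apply, Pi.sub_apply, hessFactor]
    ring

lemma phase_nonneg {τ : ℝ} (hτ : 0 < τ) (x y : En n) : 0 ≤ phase τ x y := by
  have := one_lt_coth hτ
  have := tanh_pos_of_pos hτ
  unfold phase
  positivity

lemma sqrt_coth_mul_norm_sub_le {τ : ℝ} (hτ : 0 < τ) (x y : En n) :
    √(coth τ) * ‖x - y‖ ≤ 1 + phase τ x y := by
  have ha := one_lt_coth hτ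
  have hb := tanh_pos_of_pos hτ
  have hE := phase_nonneg hτ x y
  refine abs_le_of_sq_le_sq' ?_ (by positivity) |>.2
  rw [mul_pow, Real.sq_sqrt (by positivity)]
  have : 0 ≤ ‖x + y‖ ^ 2 * Real.tanh τ := by positivity
  have : coth τ * ‖x - y‖ ^ 2 ≤ 4 * phase τ x y := by
    unfold phase
    linarith
  nlinarith [sq_nonneg (1 - phase τ x y)]

lemma norm_add_le_sqrt_coth {τ : ℝ} (hτ : 0 < τ) (x y : En n) :
    ‖x + y‖ ≤ √(coth τ) * (1 + phase τ x y) := by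
  have ha := one_lt_coth hτ
  have hab := coth_mul_tanh hτ
  have hE := phase_nonneg hτ x y
  refine abs_le_of_sq_le_sq' ?_ (by positivity) |>.2
  rw [mul_pow, Real.sq_sqrt (by positivity)]
  have h0 : 0 ≤ ‖x - y‖ ^ 2 * coth τ := by positivity
  have h1 : Real.tanh τ * ‖x + y‖ ^ 2 ≤ 4 * phase τ x y := by
    unfold phase
    linarith
  have h2 : ‖x + y‖ ^ 2 = coth τ * (Real.tanh τ * ‖x + y‖ ^ 2) := by
    rw [← mul_assoc, hab, one_mul]
  rw [h2]
  gcongr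
  nlinarith [sq_nonneg (1 - phase τ x y)]

lemma norm_combination_le {τ : ℝ} (hτ : 0 < τ) (x y : En n) {s t : ℝ}
    {q : ℝ} (hq : 0 ≤ q) (hs : |s| ≤ q * Real.tanh τ) (ht : |t| ≤ q * coth τ) :
    ‖(1 / 2 : ℝ) • (s • (x + y) - t • (x - y))‖ ≤ q * (√(coth τ) * (1 + phase τ x y)) := by
  have ha := one_lt_coth hτ
  have hb := tanh_pos_of_pos hτ
  have hab := coth_mul_tanh hτ
  have hE := phase_nonneg hτ x y
  have h1 := norm_add_le_sqrt_coth hτ x y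
  have h2 := sqrt_coth_mul_norm_sub_le hτ x y
  have hsq : √(coth τ) * √(coth τ) = coth τ := Real.mul_self_sqrt (by positivity)
  have h3 : |s| * ‖x + y‖ ≤ q * (√(coth τ) * (1 + phase τ x y)) := by
    calc |s| * ‖x + y‖ ≤ (q * 1) * (√(coth τ) * (1 + phase τ x y)) := by
          gcongr
          exact hs.trans (by gcongr; exact (Real.tanh_lt_one τ).le)
      _ = _ := by ring
  have h4 : |t| * ‖x - y‖ ≤ q * (√(coth τ) * (1 + phase τ x y)) := by
    calc |t| * ‖x - y‖ ≤ (q * coth τ) * ‖x - y‖ := by gcongr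
      _ = q * (√(coth τ) * (√(coth τ) * ‖x - y‖)) := by
        nth_rw 1 [← hsq]
        ring
      _ ≤ _ := by gcongr
  calc _ ≤ 1 / 2 * (‖s • (x + y)‖ + ‖t • (x - y)‖) := by
        rw [norm_smul, Real.norm_of_nonneg (by norm_num)]
        gcongr
        exact norm_sub_le _ _
    _ = 1 / 2 * (|s| * ‖x + y‖ + |t| * ‖x - y‖) := by
        rw [norm_smul, norm_smul, Real.norm_eq_abs, Real.norm_eq_abs]
    _ ≤ _ := by linarith

lemma norm_phaseGrad_le {τ : ℝ} (hτ : 0 < τ) (x y : En n) :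
    ‖phaseGrad τ x y‖ ≤ √(coth τ) * (1 + phase τ x y) := by
  have ha := one_lt_coth hτ
  have hb := tanh_pos_of_pos hτ
  have := norm_combination_le hτ x y (s := Real.tanh τ) (t := coth τ) zero_le_one
    (by rw [abs_of_pos hb, one_mul]) (by rw [abs_of_pos (by linarith), one_mul])
  rwa [one_mul] at this

lemma norm_phaseGradDot_le {τ : ℝ} (hτ : 0 < τ) (x y : En n) :
    ‖phaseGradDot τ x y‖ ≤ √(coth τ) ^ 3 * (1 + phase τ x y) := by
  have ha := one_lt_coth hτ
  have hb := tanh_pos_of_pos hτ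
  have hb1 := Real.tanh_lt_one τ
  have hab := coth_mul_tanh hτ
  have hsq : √(coth τ) ^ 2 = coth τ := Real.sq_sqrt (by positivity)
  have := norm_combination_le hτ x y (s := 1 - Real.tanh τ ^ 2) (t := 1 - coth τ ^ 2)
    (q := coth τ) (by positivity)
    (by rw [hab, abs_of_nonneg (by nlinarith)]; nlinarith)
    (by rw [abs_of_nonpos (by nlinarith)]; nlinarith)
  refine this.trans_eq ?_
  rw [pow_succ, hsq, mul_assoc]

lemma abs_phaseDot_le {τ : ℝ} (hτ : 0 < τ) (x y : En n) :
    |phaseDot τ x y| ≤ √(coth τ) ^ 2 * (1 + phase τ x y) := by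
  have ha := one_lt_coth hτ
  have hb := tanh_pos_of_pos hτ
  have hb1 := Real.tanh_lt_one τ
  have hab := coth_mul_tanh hτ
  rw [Real.sq_sqrt (by positivity)]
  have e : coth τ * phase τ x y = 1 / 4 * (‖x - y‖ ^ 2 * coth τ ^ 2 + ‖x + y‖ ^ 2) := by
    unfold phase
    linear_combination (1 / 4 * ‖x + y‖ ^ 2) * hab
  rw [mul_add, e, phaseDot, abs_le]
  have h1 : 0 ≤ ‖x - y‖ ^ 2 * coth τ ^ 2 := by positivity
  have h2 : 0 ≤ ‖x + y‖ ^ 2 * Real.tanh τ ^ 2 := by positivity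
  have h3 : 0 ≤ ‖x - y‖ ^ 2 * (coth τ ^ 2 - 1) := mul_nonneg (by positivity) (by nlinarith)
  have h4 : 0 ≤ ‖x + y‖ ^ 2 * (1 - Real.tanh τ ^ 2) := mul_nonneg (by positivity) (by nlinarith)
  constructor <;> nlinarith

lemma phaseHess_nonneg {τ : ℝ} (hτ : 0 < τ) : 0 ≤ phaseHess τ := by
  have ha := one_lt_coth hτ
  have hb := tanh_pos_of_pos hτ
  unfold phaseHess
  positivity

lemma phaseHess_le {τ : ℝ} (hτ : 0 < τ) : phaseHess τ ≤ √(coth τ) ^ 2 := by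
  have ha := one_lt_coth hτ
  have hb1 := Real.tanh_lt_one τ
  rw [Real.sq_sqrt (by positivity), phaseHess]
  linarith

lemma abs_hessFactor_le {τ : ℝ} (hτ : 0 < τ) (i j : Fin n) (x y : En n) :
    |hessFactor i j τ x y| ≤ 2 * (√(coth τ) ^ 2 * (1 + phase τ x y) ^ 2) := by
  have hE := phase_nonneg hτ x y
  have hp := norm_phaseGrad_le hτ x y
  have hi := (PiLp.norm_apply_le (phaseGrad τ x y) i).trans hp
  have hj := (PiLp.norm_apply_le (phaseGrad τ x y) j).trans hp
  have hc := phaseHess_le hτ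
  have hc0 := phaseHess_nonneg hτ
  have hd : |(if j = i then 1 else 0 : ℝ)| ≤ 1 := by split_ifs <;> simp
  calc |hessFactor i j τ x y|
      ≤ ‖phaseGrad τ x y i‖ * ‖phaseGrad τ x y j‖
          + phaseHess τ * |(if j = i then 1 else 0 : ℝ)| := by
        refine (abs_sub _ _).trans_eq ?_
        rw [abs_mul, abs_mul, abs_of_nonneg hc0, Real.norm_eq_abs, Real.norm_eq_abs]
    _ ≤ (√(coth τ) * (1 + phase τ x y)) * (√(coth τ) * (1 + phase τ x y))
          + √(coth τ) ^ 2 * 1 := by gcongr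
    _ ≤ (√(coth τ) * (1 + phase τ x y)) * (√(coth τ) * (1 + phase τ x y))
          + √(coth τ) ^ 2 * (1 + phase τ x y) ^ 2 := by
        gcongr
        exact one_le_pow₀ (by linarith)
    _ = _ := by ring

lemma le_coth_mul {τ : ℝ} (hτ : 0 < τ) : 1 ≤ coth τ * τ := by
  have hs : 0 < Real.sinh τ := Real.sinh_pos_iff.2 hτ
  rw [coth, div_mul_eq_mul_div, one_le_div hs]
  have hmono : MonotoneOn (fun t => Real.cosh t * t - Real.sinh t) (Ici 0) := by
    refine monotoneOn_of_deriv_nonneg (convex_Ici 0) (by fun_prop) (by fun_prop) ?_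
    intro t ht
    rw [interior_Ici] at ht
    have h : HasDerivAt (fun t => Real.cosh t * t - Real.sinh t)
        (Real.sinh t * t + Real.cosh t * 1 - Real.cosh t) t :=
      ((Real.hasDerivAt_cosh t).mul (hasDerivAt_id t)).sub (Real.hasDerivAt_sinh t)
    rw [h.deriv]
    have := mul_nonneg (Real.sinh_nonneg_iff.2 (le_of_lt ht)) (le_of_lt ht)
    linarith
  have := hmono self_mem_Ici hτ.le hτ.le
  simp at this
  linarith

lemma coth_mul_le {τ : ℝ} (hτ : 0 < τ) : coth τ * τ ≤ 1 + τ := by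
  have hs : 0 < Real.sinh τ := Real.sinh_pos_iff.2 hτ
  rw [coth, div_mul_eq_mul_div, div_le_iff₀ hs]
  have h1 : τ ≤ Real.sinh τ := Real.self_le_sinh_iff.2 hτ.le
  have h2 : Real.cosh τ - Real.sinh τ = Real.exp (-τ) := Real.cosh_sub_sinh τ
  have h3 : Real.exp (-τ) ≤ 1 := Real.exp_le_one_iff.2 (by linarith)
  nlinarith

lemma mul_one_add_pow_le_sinh {τ : ℝ} (hτ : 0 < τ) :
    τ * (1 + τ) ^ 4 ≤ 256 * Real.sinh (2 * τ) := by
  have h1 : τ ≤ Real.sinh τ := Real.self_le_sinh_iff.2 hτ.le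
  have h2 : Real.exp τ ≤ 2 * Real.cosh τ := by
    rw [Real.cosh_eq]
    linarith [Real.exp_pos (-τ)]
  have h3 : (1 + τ) ^ 4 ≤ 256 * Real.exp τ := by
    have : Real.exp τ = Real.exp (τ / 4) ^ 4 := by
      rw [← Real.exp_nat_mul]
      congr 1
      push_cast
      ring
    rw [this, show (256 : ℝ) = 4 ^ 4 by norm_num, ← mul_pow]
    gcongr
    linarith [Real.add_one_le_exp (τ / 4)]
  rw [Real.sinh_two_mul]
  calc τ * (1 + τ) ^ 4 ≤ Real.sinh τ * (256 * (2 * Real.cosh τ)) := by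
        gcongr
        linarith
    _ = _ := by ring

lemma prefactor_mul_le (hn : 1 ≤ n) {τ : ℝ} (hτ : 0 < τ) :
    prefactor n τ * (1 + τ) ^ 2 * √τ ^ n ≤ 16 := by
  have hs2 : 0 < Real.sinh (2 * τ) := Real.sinh_pos_iff.2 (by positivity)
  set S := √(Real.sinh (2 * τ)) with hS
  have hSpos : 0 < S := Real.sqrt_pos.2 hs2
  have hA : prefactor n τ ≤ (S ^ n)⁻¹ := by
    rw [prefactor, neg_div, Real.rpow_neg (by positivity)]
    have : S ^ n = Real.sinh (2 * τ) ^ ((n : ℝ) / 2) := by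
      rw [hS, Real.sqrt_eq_rpow, ← Real.rpow_mul_natCast hs2.le]
      congr 1
      ring
    rw [this]
    gcongr
    nlinarith [Real.pi_gt_three]
  have hτS : √τ ≤ S := by
    refine Real.sqrt_le_sqrt ?_
    have := Real.self_le_sinh_iff.2 (by positivity : 0 ≤ 2 * τ)
    linarith
  have hquot : √τ * (1 + τ) ^ 2 ≤ 16 * S := by
    refine abs_le_of_sq_le_sq' ?_ (by positivity) |>.2
    rw [mul_pow, mul_pow, Real.sq_sqrt hτ.le, hS, Real.sq_sqrt hs2.le]
    have := mul_one_add_pow_le_sinh hτ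
    nlinarith
  obtain ⟨m, rfl⟩ : ∃ m, n = m + 1 := ⟨n - 1, by omega⟩
  calc prefactor (m + 1) τ * (1 + τ) ^ 2 * √τ ^ (m + 1)
      ≤ (S ^ (m + 1))⁻¹ * (1 + τ) ^ 2 * √τ ^ (m + 1) := by gcongr
    _ = (S ^ (m + 1))⁻¹ * (√τ ^ m * (√τ * (1 + τ) ^ 2)) := by ring
    _ ≤ (S ^ (m + 1))⁻¹ * (S ^ m * (16 * S)) := by gcongr
    _ = 16 := by
        field_simp
        ring

lemma one_add_pow_mul_exp_neg_le (M : ℕ) {E : ℝ} (hE : 0 ≤ E) :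
    (1 + E) ^ M * Real.exp (-E) ≤ M.factorial * Real.exp 1 := by
  have h := Real.pow_div_factorial_le_exp (1 + E) (by linarith) M
  rw [div_le_iff₀ (by positivity), Real.exp_add] at h
  calc (1 + E) ^ M * Real.exp (-E)
      ≤ (Real.exp 1 * Real.exp E * M.factorial) * Real.exp (-E) := by gcongr
    _ = M.factorial * Real.exp 1 * (Real.exp E * Real.exp (-E)) := by ring
    _ = _ := by rw [← Real.exp_add]; simp

/-- Parabolic decay of the Mehler kernel weighted by powers of `√(coth τ)` and of the phase. -/
lemma mehler_weighted_le (hn : 1 ≤ n) {m : ℕ} (hm : m ≤ 4) (k : ℕ) {τ : ℝ} (hτ : 0 < τ)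
    (x y : En n) :
    √(coth τ) ^ m * (1 + phase τ x y) ^ k * Mehler n τ x y ≤
      16 * 2 ^ (n + m) * ((n + m + k).factorial * Real.exp 1) *
        (‖x - y‖ + √τ) ^ (-((n : ℝ) + m)) := by
  have ha := one_lt_coth hτ
  have hE := phase_nonneg hτ x y
  have hs : 0 < √τ := Real.sqrt_pos.2 hτ
  set E := phase τ x y
  set α := √(coth τ)
  have hαs1 : 1 ≤ α * √τ := by
    rw [← Real.sqrt_mul (by positivity)]
    exact Real.one_le_sqrt.2 (le_coth_mul hτ)
  have hαs2 : (α * √τ) ^ m ≤ (1 + τ) ^ 2 := by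
    calc (α * √τ) ^ m ≤ (α * √τ) ^ 4 := pow_le_pow_right₀ hαs1 hm
      _ = (coth τ * τ) ^ 2 := by
        rw [mul_pow, show α ^ 4 = (α ^ 2) ^ 2 by ring, show √τ ^ 4 = (√τ ^ 2) ^ 2 by ring,
          Real.sq_sqrt (by positivity), Real.sq_sqrt hτ.le, mul_pow]
      _ ≤ _ := by
        gcongr
        exact coth_mul_le hτ
  have hA0 : 0 ≤ prefactor n τ := by
    have := Real.sinh_pos_iff.2 (by positivity : 0 < 2 * τ)
    unfold prefactor
    positivity
  have hrad : ‖x - y‖ + √τ ≤ √τ * (2 * (1 + E)) := by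
    have h1 : ‖x - y‖ ≤ √τ * (α * ‖x - y‖) := by
      nlinarith [norm_nonneg (x - y)]
    have h2 : √τ * (α * ‖x - y‖) ≤ √τ * (1 + E) := by
      gcongr
      exact sqrt_coth_mul_norm_sub_le hτ x y
    nlinarith
  have hR : 0 < ‖x - y‖ + √τ := by positivity
  rw [Real.rpow_neg hR.le, show (n : ℝ) + m = ((n + m : ℕ) : ℝ) by push_cast; rfl,
    Real.rpow_natCast, ← div_eq_mul_inv, le_div_iff₀ (by positivity), mehler_eq hτ]
  calc α ^ m * (1 + E) ^ k * (prefactor n τ * Real.exp (-E)) * (‖x - y‖ + √τ) ^ (n + m)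
      ≤ α ^ m * (1 + E) ^ k * (prefactor n τ * Real.exp (-E)) *
          (√τ * (2 * (1 + E))) ^ (n + m) := by gcongr
    _ = (prefactor n τ * (α * √τ) ^ m * √τ ^ n) * 2 ^ (n + m) *
          ((1 + E) ^ (n + m + k) * Real.exp (-E)) := by
        simp only [mul_pow, pow_add]
        ring
    _ ≤ (prefactor n τ * (1 + τ) ^ 2 * √τ ^ n) * 2 ^ (n + m) *
          ((n + m + k).factorial * Real.exp 1) := by
        exact mul_le_mul (by gcongr) (one_add_pow_mul_exp_neg_le _ hE) (by positivity)
          (by positivity)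
    _ ≤ 16 * 2 ^ (n + m) * ((n + m + k).factorial * Real.exp 1) := by
        gcongr
        exact prefactor_mul_le hn hτ

lemma mehler_nonneg {τ : ℝ} (hτ : 0 < τ) (x y : En n) : 0 ≤ Mehler n τ x y := by
  have := Real.sinh_pos_iff.2 (by positivity : 0 < 2 * τ)
  rw [mehler_eq hτ, prefactor]
  positivity

lemma abs_mij_le {τ : ℝ} (hτ : 0 < τ) (i j : Fin n) (x y : En n) :
    |Mij n i j τ x y| ≤
      2 * (√(coth τ) ^ 2 * (1 + phase τ x y) ^ 2 * Mehler n τ x y) := by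
  have hW := mehler_nonneg hτ x y
  rw [mij_eq hτ, abs_mul, abs_of_nonneg hW, ← mul_assoc]
  gcongr
  exact abs_hessFactor_le hτ i j x y

lemma norm_proj_le_one (i : Fin n) : ‖(EuclideanSpace.proj i : En n →L[ℝ] ℝ)‖ ≤ 1 :=
  ContinuousLinearMap.opNorm_le_bound _ zero_le_one fun z => by
    simpa using PiLp.norm_apply_le z i

lemma norm_fderiv_mij_le {τ : ℝ} (hτ : 0 < τ) (i j : Fin n) (x y : En n) :
    ‖fderiv ℝ (Mij n i j τ x) y‖ ≤
      4 * (√(coth τ) ^ 3 * (1 + phase τ x y) ^ 3 * Mehler n τ x y) := by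
  have hW := mehler_nonneg hτ x y
  have hE := phase_nonneg hτ x y
  have hp := norm_phaseGrad_le hτ x y
  have hc := phaseHess_le hτ
  have hc0 := phaseHess_nonneg hτ
  have hM := abs_hessFactor_le hτ i j x y
  have hproj (k l : Fin n) : ‖(phaseHess τ * phaseGrad τ x y k) •
      (EuclideanSpace.proj l : En n →L[ℝ] ℝ)‖ ≤ √(coth τ) ^ 3 * (1 + phase τ x y) ^ 3 := by
    have hk := (PiLp.norm_apply_le (phaseGrad τ x y) k).trans hp
    rw [norm_smul, norm_mul, Real.norm_of_nonneg hc0]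
    calc phaseHess τ * ‖phaseGrad τ x y k‖ * ‖(EuclideanSpace.proj l : En n →L[ℝ] ℝ)‖
        ≤ √(coth τ) ^ 2 * (√(coth τ) * (1 + phase τ x y)) * 1 := by
          gcongr
          exact norm_proj_le_one l
      _ = √(coth τ) ^ 3 * (1 + phase τ x y) ^ 1 := by ring
      _ ≤ _ := by
        gcongr
        · linarith
        · norm_num
  have hlast : ‖hessFactor i j τ x y • innerSL ℝ (phaseGrad τ x y)‖ ≤
      2 * (√(coth τ) ^ 3 * (1 + phase τ x y) ^ 3) := by
    rw [norm_smul, innerSL_apply_norm, Real.norm_eq_abs]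
    calc |hessFactor i j τ x y| * ‖phaseGrad τ x y‖
        ≤ 2 * (√(coth τ) ^ 2 * (1 + phase τ x y) ^ 2) * (√(coth τ) * (1 + phase τ x y)) := by
          gcongr
      _ = _ := by ring
  rw [(hasFDerivAt_mij hτ i j x y).fderiv, norm_smul, Real.norm_of_nonneg hW]
  calc _ ≤ Mehler n τ x y * (4 * (√(coth τ) ^ 3 * (1 + phase τ x y) ^ 3)) := by
        gcongr
        refine (norm_sub_le _ _).trans ?_
        linarith [norm_add_le_of_le (hproj i j) (hproj j i)]
    _ = _ := by ring

lemma abs_deriv_mij_le {τ : ℝ} (hτ : 0 < τ) (i j : Fin n) (x y : En n) :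
    |deriv (fun σ => Mij n i j σ x y) τ| ≤
      (5 + 2 * n) * (√(coth τ) ^ 4 * (1 + phase τ x y) ^ 3 * Mehler n τ x y) := by
  have hW := mehler_nonneg hτ x y
  have hE := phase_nonneg hτ x y
  have ha := one_lt_coth hτ
  have hb := tanh_pos_of_pos hτ
  have hb1 := Real.tanh_lt_one τ
  have hp := norm_phaseGrad_le hτ x y
  have hq := norm_phaseGradDot_le hτ x y
  have hc := phaseHess_le hτ
  have hc0 := phaseHess_nonneg hτ
  have hM := abs_hessFactor_le hτ i j x y
  have hD := abs_phaseDot_le hτ x y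
  set α := √(coth τ)
  have hα : α ^ 4 = coth τ ^ 2 := by
    rw [show α ^ 4 = (α ^ 2) ^ 2 by ring, Real.sq_sqrt (by positivity)]
  have hα0 : 0 ≤ α := Real.sqrt_nonneg _
  set F := 1 + phase τ x y
  have hF : 1 ≤ F := by simp only [F]; linarith
  have hprod (k l : Fin n) : |phaseGradDot τ x y k * phaseGrad τ x y l| ≤ α ^ 4 * F ^ 3 := by
    have hk := (PiLp.norm_apply_le (phaseGradDot τ x y) k).trans hq
    have hl := (PiLp.norm_apply_le (phaseGrad τ x y) l).trans hp
    rw [Real.norm_eq_abs] at hk hl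
    rw [abs_mul]
    calc _ ≤ (α ^ 3 * F) * (α * F) := by gcongr
      _ = α ^ 4 * F ^ 2 := by ring
      _ ≤ _ := by
        gcongr
        · norm_num
  have hhess : |((1 - coth τ ^ 2) + (1 - Real.tanh τ ^ 2)) / 2 * (if j = i then 1 else 0)| ≤
      α ^ 4 * F ^ 3 := by
    have hd : |(if j = i then 1 else 0 : ℝ)| ≤ 1 := by split_ifs <;> simp
    rw [abs_mul]
    calc _ ≤ α ^ 4 * 1 := by
          gcongr
          rw [hα, abs_le]
          constructor <;> nlinarith
      _ ≤ _ := by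
        gcongr
        exact one_le_pow₀ hF
  have htime : |hessFactor i j τ x y * (n * phaseHess τ + phaseDot τ x y)| ≤
      (2 * n + 2) * (α ^ 4 * F ^ 3) := by
    rw [abs_mul]
    calc _ ≤ 2 * (α ^ 2 * F ^ 2) * (n * (α ^ 2 * F) + α ^ 2 * F) := by
          gcongr
          refine (abs_add_le _ _).trans ?_
          rw [abs_of_nonneg (by positivity)]
          gcongr
          exact hc.trans (le_mul_of_one_le_right (by positivity) hF)
      _ = _ := by ring
  rw [(hasDerivAt_mij hτ i j x y).deriv, abs_mul, abs_of_nonneg hW, ← mul_assoc]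
  gcongr
  have h2 := hprod j i
  rw [mul_comm] at h2
  refine (abs_sub _ _).trans ?_
  refine (add_le_add_left (abs_sub _ _) _).trans ?_
  linarith [abs_add_le (phaseGradDot τ x y i * phaseGrad τ x y j)
    (phaseGrad τ x y i * phaseGradDot τ x y j), hprod i j]

end MehlerBounds

/-- parabolic Calderón–Zygmund estimates for the kernel
`∂_{y_iy_j}𝒲_τ(x,y)`: size bound with exponent `n+2`, spatial gradient bound with exponent
`n+3`, and time derivative bound with exponent `n+4`, with `C = C(n)`. -/
theorem mehler_kernel_CZ_estimates (n : ℕ) (hn : 1 ≤ n) (i j : Fin n) :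
    ∃ C : ℝ, 0 < C ∧ ∀ (τ : ℝ), 0 < τ → ∀ x y : En n,
      |Mij n i j τ x y| ≤ C * (‖x - y‖ + Real.sqrt τ) ^ (-((n : ℝ) + 2)) ∧
      ‖fderiv ℝ (fun y' : En n => Mij n i j τ x y') y‖ ≤
          C * (‖x - y‖ + Real.sqrt τ) ^ (-((n : ℝ) + 3)) ∧
      |deriv (fun σ : ℝ => Mij n i j σ x y) τ| ≤
          C * (‖x - y‖ + Real.sqrt τ) ^ (-((n : ℝ) + 4)) := by
  set K : ℕ → ℕ → ℝ := fun m k => 16 * 2 ^ (n + m) * ((n + m + k).factorial * Real.exp 1)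
  have hK (m k : ℕ) : 0 < K m k := by positivity
  have h1 := hK 2 2
  have h2 := hK 3 3
  have h3 := mul_pos (by positivity : (0 : ℝ) < 5 + 2 * n) (hK 4 3)
  obtain ⟨C, hC⟩ : ∃ C, C = 2 * K 2 2 + 4 * K 3 3 + (5 + 2 * n) * K 4 3 := ⟨_, rfl⟩
  have hbound {B c : ℝ} (hc : 0 ≤ c) {m : ℕ} (hm : m ≤ 4) (k : ℕ) {τ : ℝ} (hτ : 0 < τ)
      {x y : En n} (hB : B ≤ c * (√(coth τ) ^ m * (1 + phase τ x y) ^ k * Mehler n τ x y))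
      (hcC : c * K m k ≤ C) : B ≤ C * (‖x - y‖ + √τ) ^ (-((n : ℝ) + m)) := by
    refine hB.trans ((mul_le_mul_of_nonneg_left (mehler_weighted_le hn hm k hτ x y) hc).trans ?_)
    rw [← mul_assoc]
    gcongr
  refine ⟨C, by linarith, fun τ hτ x y => ⟨?_, ?_, ?_⟩⟩
  · simpa only [Nat.cast_ofNat] using
      hbound (by norm_num) (by norm_num) 2 hτ (abs_mij_le hτ i j x y) (by linarith)
  · simpa only [Nat.cast_ofNat] using
      hbound (by norm_num) (by norm_num) 3 hτ (norm_fderiv_mij_le hτ i j x y) (by linarith)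
  · simpa only [Nat.cast_ofNat] using
      hbound (by positivity) (by norm_num) 3 hτ (abs_deriv_mij_le hτ i j x y) (by linarith)
end
end
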